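/- arXiv:1810.06052 — 3 statements merged into one kernel-verified Lean document; each statement's English description precedes it below -/
import Mathlib

section
/- The statistics (L, Asc, ls) and (L, Asc, vls) have the same joint distribution over the set of RGFs of length n, for all n ≥ 1. That is, there is a bijection ξ on RG(n) with L(w) = L(ξ(w)), Asc(w) = Asc(ξ(w)), and vls(w) = ls(ξ(w)). -/
open Finset

variable {n : ℕ}

/-- Positions of leftmost occurrences of letters in the word `w`. -/
def Lset (w : Fin n → ℕ) : Finset (Fin n) :=
  Finset.univ.filter fun i => ∀ j, j < i → w j ≠ w i

/-- Positions of rightmost occurrences of letters in the word `w`. -/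
def Rset (w : Fin n → ℕ) : Finset (Fin n) :=
  Finset.univ.filter fun i => ∀ j, i < j → w j ≠ w i

/-- The maximum letter of the word `w`. -/
def bk (w : Fin n → ℕ) : ℕ := Finset.univ.sup w

/-- The (1-indexed) position of the rightmost `1` in `w`. -/
def pro (w : Fin n → ℕ) : ℕ :=
  (Finset.univ.filter fun i => w i = 1).sup fun i => (i : ℕ) + 1

def lsi (w : Fin n → ℕ) (i : Fin n) : ℕ :=
  ((Lset w).filter fun j => j < i ∧ w j < w i).card

def rsi (w : Fin n → ℕ) (i : Fin n) : ℕ :=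
  ((Rset w).filter fun j => i < j ∧ w j < w i).card

def vlsi (w : Fin n → ℕ) (i : Fin n) : ℕ :=
  if i ∉ Rset w ∧ pro w < (i : ℕ) + 1 then lsi w i - 1
  else if i ∈ Rset w ∧ (i : ℕ) + 1 < pro w then lsi w i + 1
  else lsi w i

def vrsi (w : Fin n → ℕ) (i : Fin n) : ℕ :=
  if i ∉ Rset w ∧ pro w < (i : ℕ) + 1 then rsi w i + 1
  else if i ∈ Rset w ∧ (i : ℕ) + 1 < pro w then rsi w i - 1
  else rsi w i

def ls (w : Fin n → ℕ) : ℕ := ∑ i, lsi w i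
def rs (w : Fin n → ℕ) : ℕ := ∑ i, rsi w i
def vls (w : Fin n → ℕ) : ℕ := ∑ i, vlsi w i
def vrs (w : Fin n → ℕ) : ℕ := ∑ i, vrsi w i

/-- `w` is a restricted growth function: positive letters, `w₁ = 1`, and each
letter is at most one more than the maximum of the preceding letters. -/
def IsRGF (w : Fin n → ℕ) : Prop :=
  (∀ i, 1 ≤ w i) ∧ (∀ i : Fin n, (i : ℕ) = 0 → w i = 1) ∧
    ∀ i : Fin n, 0 < (i : ℕ) → w i ≤ (Finset.univ.filter fun j => j < i).sup w + 1

/-- The ascent set of `w`. -/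
def AscSet (w : Fin n → ℕ) : Finset (Fin n) :=
  Finset.univ.filter fun i => ∃ j : Fin n, (j : ℕ) = (i : ℕ) + 1 ∧ w i < w j

/-- The number of elements of `L` smaller than `k`. -/
def below (L : Finset (Fin n)) (k : ℕ) : ℕ := #(L.filter fun l : Fin n => (l : ℕ) < k)

theorem below_mono (L : Finset (Fin n)) {a b : ℕ} (h : a ≤ b) : below L a ≤ below L b := by
  apply card_le_card
  intro l
  simp only [mem_filter]
  exact fun hl => ⟨hl.1, by omega⟩

theorem below_succ_of_mem {L : Finset (Fin n)} {i : Fin n} (h : i ∈ L) :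
    below L (i + 1) = below L i + 1 := by
  have : (L.filter fun l : Fin n => (l : ℕ) < i + 1) =
      insert i (L.filter fun l : Fin n => (l : ℕ) < i) := by
    ext l
    simp only [mem_filter, mem_insert, Fin.ext_iff]
    constructor
    · intro hl
      by_cases hli : (l : ℕ) = i
      · exact Or.inl hli
      · exact Or.inr ⟨hl.1, by omega⟩
    · rintro (hl | hl)
      · rw [Fin.ext hl]
        exact ⟨h, by omega⟩
      · exact ⟨hl.1, by omega⟩
  unfold below
  rw [this, card_insert_of_notMem (by simp)]

theorem below_succ_of_notMem {L : Finset (Fin n)} {i : Fin n} (h : i ∉ L) :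
    below L (i + 1) = below L i := by
  unfold below
  congr 1
  ext l
  simp only [mem_filter]
  refine and_congr_right fun hl => ⟨fun hli => ?_, fun hli => by omega⟩
  have : l ≠ i := fun e => h (e ▸ hl)
  have : (l : ℕ) ≠ i := fun e => this (Fin.ext e)
  omega

theorem exists_below_eq (L : Finset (Fin n)) {v k : ℕ} (hk : k ≤ n) (hv : 1 ≤ v)
    (h : v ≤ below L k) : ∃ l ∈ L, (l : ℕ) < k ∧ below L (l + 1) = v := by
  induction k with
  | zero =>
    simp [below] at h
    omega
  | succ k ih =>
    by_cases hkL : (⟨k, hk⟩ : Fin n) ∈ L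
    · have hs := below_succ_of_mem hkL
      simp only at hs
      by_cases hvk : v ≤ below L k
      · obtain ⟨l, hl, hlk, hlv⟩ := ih (by omega) hvk
        exact ⟨l, hl, by omega, hlv⟩
      · exact ⟨_, hkL, by simp, by simp only; omega⟩
    · have hs := below_succ_of_notMem hkL
      simp only at hs
      obtain ⟨l, hl, hlk, hlv⟩ := ih (by omega) (by omega)
      exact ⟨l, hl, by omega, hlv⟩

theorem below_lt_of_mem {L : Finset (Fin n)} {i : Fin n} (hi : i ∈ L) {k : ℕ} (hk : k ≤ i) :
    below L k < below L (i + 1) := by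
  have := below_succ_of_mem hi
  have := below_mono L hk
  omega

/-- Restricted growth functions with leftmost positions `L`, described letter by letter. -/
structure HasLeftmost (L : Finset (Fin n)) (w : Fin n → ℕ) : Prop where
  zero_mem : ∀ i : Fin n, (i : ℕ) = 0 → i ∈ L
  pos : ∀ i, 1 ≤ w i
  le : ∀ i, w i ≤ below L (i + 1)
  eq : ∀ i ∈ L, w i = below L (i + 1)

theorem IsRGF.image_eq {w : Fin n → ℕ} (hw : IsRGF w) {k : ℕ} (hk : k ≤ n) :
    (univ.filter fun j : Fin n => (j : ℕ) < k).image w = Icc 1 (below (Lset w) k) := by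
  induction k with
  | zero => simp [below]
  | succ k ih =>
    have ih := ih (by omega)
    set i : Fin n := ⟨k, hk⟩ with hi
    have hins : (univ.filter fun j : Fin n => (j : ℕ) < k + 1) =
        insert i (univ.filter fun j : Fin n => (j : ℕ) < k) := by
      ext j
      simp only [mem_filter, mem_univ, true_and, mem_insert, Fin.ext_iff, hi]
      omega
    have hpos := hw.1 i
    rw [hins, image_insert, ih]
    by_cases hiL : i ∈ Lset w
    · have hs : below (Lset w) (k + 1) = below (Lset w) k + 1 := below_succ_of_mem hiL
      have hni : w i ∉ Icc 1 (below (Lset w) k) := by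
        rw [← ih]
        intro hmem
        obtain ⟨j, hj, hjw⟩ := mem_image.1 hmem
        exact (mem_filter.1 hiL).2 j (Fin.lt_def.2 (mem_filter.1 hj).2) hjw
      have hle : w i ≤ below (Lset w) k + 1 := by
        by_cases hk0 : k = 0
        · have := hw.2.1 i hk0
          omega
        · refine (hw.2.2 i (by simp only [hi]; omega)).trans (Nat.succ_le_succ ?_)
          refine Finset.sup_le fun j hj => ?_
          have : w j ∈ Icc 1 (below (Lset w) k) := by
            rw [← ih]
            exact mem_image_of_mem w
              (mem_filter.2 ⟨mem_univ j, Fin.lt_def.1 (mem_filter.1 hj).2⟩)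
          exact (mem_Icc.1 this).2
      rw [hs]
      ext v
      simp only [mem_insert, mem_Icc] at hni ⊢
      omega
    · have hs : below (Lset w) (k + 1) = below (Lset w) k := below_succ_of_notMem hiL
      rw [hs, insert_eq_of_mem]
      rw [← ih]
      simp only [Lset, mem_filter, mem_univ, true_and, not_forall, not_not] at hiL
      obtain ⟨j, hj, hjw⟩ := hiL
      rw [← hjw]
      exact mem_image_of_mem w (mem_filter.2 ⟨mem_univ j, Fin.lt_def.1 hj⟩)

theorem IsRGF.hasLeftmost {w : Fin n → ℕ} (hw : IsRGF w) : HasLeftmost (Lset w) w where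
  zero_mem i hi := by
    simp only [Lset, mem_filter, mem_univ, true_and]
    intro j hj
    rw [Fin.lt_def] at hj
    omega
  pos := hw.1
  le i := by
    have : w i ∈ Icc 1 (below (Lset w) (i + 1)) := by
      rw [← hw.image_eq i.2]
      exact mem_image_of_mem w (by simp)
    exact (mem_Icc.1 this).2
  eq i hi := by
    have h1 : w i ∈ Icc 1 (below (Lset w) (i + 1)) := by
      rw [← hw.image_eq i.2]
      exact mem_image_of_mem w (by simp)
    have h2 : w i ∉ Icc 1 (below (Lset w) i) := by
      rw [← hw.image_eq i.2.le]
      intro hmem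
      obtain ⟨j, hj, hjw⟩ := mem_image.1 hmem
      exact (mem_filter.1 hi).2 j (Fin.lt_def.2 (mem_filter.1 hj).2) hjw
    have := below_succ_of_mem hi
    rw [mem_Icc] at h1 h2
    omega

namespace HasLeftmost

variable {L : Finset (Fin n)} {w : Fin n → ℕ}

theorem lset_eq (h : HasLeftmost L w) : Lset w = L := by
  ext i
  simp only [Lset, mem_filter, mem_univ, true_and]
  constructor
  · intro hi
    by_contra hiL
    have hle := h.le i
    rw [below_succ_of_notMem hiL] at hle
    obtain ⟨l, hl, hli, hlv⟩ := exists_below_eq L i.2.le (h.pos i) hle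
    exact hi l (Fin.lt_def.2 hli) ((h.eq l hl).trans hlv)
  · intro hi j hj
    have := h.le j
    have := h.eq i hi
    have := below_lt_of_mem hi (k := j + 1) (by rw [Fin.lt_def] at hj; omega)
    omega

theorem isRGF (h : HasLeftmost L w) : IsRGF w := by
  have hb (i : Fin n) : below L i ≤ (univ.filter fun j => j < i).sup w := by
    rcases Nat.eq_zero_or_pos (below L i) with h0 | h0
    · omega
    · obtain ⟨l, hl, hli, hlv⟩ := exists_below_eq L i.2.le h0 le_rfl
      rw [← hlv, ← h.eq l hl]
      exact le_sup (f := w) (mem_filter.2 ⟨mem_univ l, Fin.lt_def.2 hli⟩)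
  have hs (i : Fin n) : w i ≤ below L i + 1 := by
    have := h.le i
    by_cases hi : i ∈ L
    · rwa [below_succ_of_mem hi] at this
    · rw [below_succ_of_notMem hi] at this
      omega
  refine ⟨h.pos, fun i hi => ?_, fun i _ => (hs i).trans (Nat.succ_le_succ (hb i))⟩
  have h1 := hs i
  have h2 := h.pos i
  have h3 : below L i = 0 := by simp [below, hi]
  omega

theorem lsi_eq (h : HasLeftmost L w) (i : Fin n) : lsi w i = w i - 1 := by
  unfold lsi
  rw [h.lset_eq]
  have : w i - 1 = #(Icc 1 (w i - 1)) := by simp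
  rw [this]
  refine card_bij (fun l _ => w l) ?_ ?_ ?_
  · intro l hl
    simp only [mem_filter] at hl
    have := h.pos l
    rw [mem_Icc]
    omega
  · intro l hl l' hl' e
    simp only [mem_filter] at hl hl'
    rw [h.eq l hl.1, h.eq l' hl'.1] at e
    rcases lt_trichotomy l l' with hlt | heq | hlt
    · have := below_lt_of_mem hl'.1 (k := l + 1) (by rw [Fin.lt_def] at hlt; omega)
      omega
    · exact heq
    · have := below_lt_of_mem hl.1 (k := l' + 1) (by rw [Fin.lt_def] at hlt; omega)
      omega
  · intro v hv
    rw [mem_Icc] at hv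
    have hle := h.le i
    obtain ⟨l, hl, hli, hlv⟩ := exists_below_eq L (k := i + 1) i.2 hv.1 (by omega)
    have hwl := h.eq l hl
    refine ⟨l, ?_, by omega⟩
    have hne : l ≠ i := fun e => by
      rw [e] at hwl
      rw [e] at hlv
      omega
    have : (l : ℕ) ≠ i := fun e => hne (Fin.ext e)
    simp only [mem_filter, Fin.lt_def]
    exact ⟨hl, by omega, by omega⟩

theorem pred_mem_ascSet (h : HasLeftmost L w) {i j : Fin n} (hij : (j : ℕ) = i + 1)
    (hj : j ∈ L) : i ∈ AscSet w := by
  simp only [AscSet, mem_filter, mem_univ, true_and]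
  refine ⟨j, hij, ?_⟩
  have := h.le i
  have := h.eq j hj
  have := below_lt_of_mem hj (k := i + 1) (by omega)
  omega

end HasLeftmost

theorem card_lset (w : Fin n → ℕ) : #(Lset w) = #(univ.image w) := by
  refine card_bij (fun i _ => w i) (fun i _ => mem_image_of_mem w (mem_univ i)) ?_ ?_
  · intro i hi j hj e
    simp only [Lset, mem_filter, mem_univ, true_and] at hi hj
    rcases lt_trichotomy i j with hlt | heq | hlt
    · exact absurd e (hj i hlt)
    · exact heq
    · exact absurd e.symm (hi j hlt)
  · intro v hv
    obtain ⟨i, -, hi⟩ := mem_image.1 hv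
    have hne : (univ.filter fun j => w j = v).Nonempty := ⟨i, by simpa using hi⟩
    have hm := min'_mem _ hne
    refine ⟨_, ?_, (mem_filter.1 hm).2⟩
    simp only [Lset, mem_filter, mem_univ, true_and]
    intro j hj e
    have := min'_le (univ.filter fun j => w j = v) j
      (mem_filter.2 ⟨mem_univ j, e.trans (mem_filter.1 hm).2⟩)
    exact absurd hj (not_lt.2 this)

theorem card_rset (w : Fin n → ℕ) : #(Rset w) = #(univ.image w) := by
  refine card_bij (fun i _ => w i) (fun i _ => mem_image_of_mem w (mem_univ i)) ?_ ?_
  · intro i hi j hj e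
    simp only [Rset, mem_filter, mem_univ, true_and] at hi hj
    rcases lt_trichotomy i j with hlt | heq | hlt
    · exact absurd e.symm (hi j hlt)
    · exact heq
    · exact absurd e (hj i hlt)
  · intro v hv
    obtain ⟨i, -, hi⟩ := mem_image.1 hv
    have hne : (univ.filter fun j => w j = v).Nonempty := ⟨i, by simpa using hi⟩
    have hm := max'_mem _ hne
    refine ⟨_, ?_, (mem_filter.1 hm).2⟩
    simp only [Rset, mem_filter, mem_univ, true_and]
    intro j hj e
    have := le_max' (univ.filter fun j => w j = v) j
      (mem_filter.2 ⟨mem_univ j, e.trans (mem_filter.1 hm).2⟩)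
    exact absurd hj (not_lt.2 this)

/-- `p` is the position of the rightmost `1` in `w`. -/
def IsLastOne (w : Fin n → ℕ) (p : Fin n) : Prop := w p = 1 ∧ ∀ i, p < i → w i ≠ 1

theorem IsRGF.exists_isLastOne (hn : 1 ≤ n) {w : Fin n → ℕ} (hw : IsRGF w) :
    ∃ p, IsLastOne w p := by
  have hne : (univ.filter fun j => w j = 1).Nonempty :=
    ⟨⟨0, hn⟩, by simpa using hw.2.1 ⟨0, hn⟩ rfl⟩
  refine ⟨_, (mem_filter.1 (max'_mem _ hne)).2, fun i hi e => ?_⟩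
  exact absurd hi (not_lt.2 (le_max' _ i (mem_filter.2 ⟨mem_univ i, e⟩)))

theorem IsLastOne.pro_eq {w : Fin n → ℕ} {p : Fin n} (h : IsLastOne w p) : pro w = p + 1 := by
  apply le_antisymm
  · refine Finset.sup_le fun i hi => ?_
    by_contra hlt
    exact h.2 i (by rw [Fin.lt_def]; omega) (mem_filter.1 hi).2
  · exact le_sup (f := fun i : Fin n => (i : ℕ) + 1) (mem_filter.2 ⟨mem_univ p, h.1⟩)

theorem IsLastOne.mem_rset {w : Fin n → ℕ} {p : Fin n} (h : IsLastOne w p) : p ∈ Rset w := by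
  simp only [Rset, mem_filter, mem_univ, true_and]
  intro j hj
  rw [h.1]
  exact h.2 j hj

theorem HasLeftmost.vls_eq {L : Finset (Fin n)} {w : Fin n → ℕ} (h : HasLeftmost L w)
    {p : Fin n} (hp : IsLastOne w p) :
    (vls w : ℤ) = ∑ i, ((w i : ℤ) - 1) + #L - ∑ i, if p ≤ i then 1 else 0 := by
  have hR : (#L : ℤ) = ∑ i, if i ∈ Rset w then 1 else 0 := by
    rw [← h.lset_eq, card_lset, ← card_rset]
    simp
  rw [hR, ← sum_add_distrib, ← sum_sub_distrib, vls, Nat.cast_sum]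
  refine sum_congr rfl fun i _ => ?_
  rw [vlsi, hp.pro_eq, h.lsi_eq]
  have h1 := h.pos i
  rcases lt_trichotomy (p : ℕ) i with hlt | heq | hlt
  · have h2 := hp.2 i (Fin.lt_def.2 hlt)
    have hle : p ≤ i := Fin.le_def.2 hlt.le
    by_cases hi : i ∈ Rset w <;> simp [hi, hle] <;> split_ifs <;> omega
  · obtain rfl := Fin.ext heq
    have h2 := hp.1
    simp [hp.mem_rset, h2]
  · have hle : ¬ p ≤ i := by rw [Fin.le_def]; omega
    by_cases hi : i ∈ Rset w <;> simp [hi, hle] <;> split_ifs <;> omega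

theorem HasLeftmost.ls_eq {L : Finset (Fin n)} {w : Fin n → ℕ} (h : HasLeftmost L w) :
    (ls w : ℤ) = ∑ i, ((w i : ℤ) - 1) := by
  rw [ls, Nat.cast_sum]
  refine sum_congr rfl fun i _ => ?_
  rw [h.lsi_eq]
  have := h.pos i
  omega

/-- Candidate first positions for a rotation ending at `p` that crosses no position in `D`. -/
def rotationStarts (L D : Finset (Fin n)) (p : Fin n) : Finset (Fin n) :=
  univ.filter fun s => s ≤ p ∧ (s ∉ L ∨ s = p) ∧ ∀ i, s ≤ i → i < p → i ∉ D

theorem rotationStarts_nonempty (L D : Finset (Fin n)) (p : Fin n) :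
    (rotationStarts L D p).Nonempty :=
  ⟨p, by
    simp only [rotationStarts, mem_filter, mem_univ, true_and]
    exact ⟨le_rfl, Or.inr trivial, fun i h1 h2 => absurd h1 (not_le.2 h2)⟩⟩

def rotationStart (L D : Finset (Fin n)) (p : Fin n) : Fin n :=
  (rotationStarts L D p).min' (rotationStarts_nonempty L D p)

theorem rotationStart_spec (L D : Finset (Fin n)) (p : Fin n) :
    rotationStart L D p ≤ p ∧ (rotationStart L D p ∉ L ∨ rotationStart L D p = p) ∧
      ∀ i, rotationStart L D p ≤ i → i < p → i ∉ D := by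
  have := min'_mem _ (rotationStarts_nonempty L D p)
  exact (mem_filter.1 this).2

theorem mem_of_succ_eq_rotationStart {L D : Finset (Fin n)} {p i : Fin n}
    (h : (rotationStart L D p : ℕ) = i + 1) (hi : i ∉ D) : i ∈ L := by
  by_contra hiL
  obtain ⟨h1, -, h3⟩ := rotationStart_spec L D p
  have : i ∈ rotationStarts L D p := by
    simp only [rotationStarts, mem_filter, mem_univ, true_and]
    rw [Fin.le_def] at h1
    refine ⟨by rw [Fin.le_def]; omega, Or.inl hiL, fun j hj hjp => ?_⟩
    rcases eq_or_lt_of_le hj with e | hlt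
    · exact e ▸ hi
    · exact h3 j (by rw [Fin.lt_def] at hlt; rw [Fin.le_def]; omega) hjp
  have := min'_le _ i this
  change rotationStart L D p ≤ i at this
  rw [Fin.le_def] at this
  omega

/-- The rotation of the interval `[s, p]` that sends `s` to `p` and every other element to its
predecessor. -/
def rotate (s p i : Fin n) : Fin n :=
  if i < s ∨ p < i then i else if i = s then p else ⟨i - 1, by omega⟩

theorem rotate_of_lt {s p i : Fin n} (h : i < s) : rotate s p i = i := by simp [rotate, h]

theorem rotate_of_gt {s p i : Fin n} (h : p < i) : rotate s p i = i := by simp [rotate, h]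

theorem rotate_start {s p : Fin n} (h : s ≤ p) : rotate s p s = p := by
  simp [rotate, not_lt.2 h]

theorem rotate_succ {s p i j : Fin n} (hs : s ≤ i) (hp : j ≤ p) (h : (j : ℕ) = i + 1) :
    rotate s p j = i := by
  rw [Fin.le_def] at hs hp
  rw [rotate, if_neg, if_neg]
  · ext
    simp only
    omega
  · rw [Fin.ext_iff]
    omega
  · simp only [Fin.lt_def]
    omega

theorem rotate_bijective {s p : Fin n} (h : s ≤ p) : Function.Bijective (rotate s p) := by
  rw [← Finite.injective_iff_bijective]
  intro i j e
  rw [Fin.le_def] at h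
  unfold rotate at e
  simp only [Fin.lt_def, Fin.ext_iff] at e ⊢
  split_ifs at e <;> first | omega | (simp only at e; omega)

/-- Replace the letter at `p` by the largest letter up to `p`, rotate it to the front of its
`D`-block, and lower every letter right of `p` that is not a leftmost occurrence. -/
def shiftWord (L D : Finset (Fin n)) (p : Fin n) (w : Fin n → ℕ) (i : Fin n) : ℕ :=
  (if rotate (rotationStart L D p) p i = p then below L (p + 1)
    else w (rotate (rotationStart L D p) p i)) - if p < i ∧ i ∉ L then 1 else 0

section shiftWord

variable {L D : Finset (Fin n)} {p : Fin n} {w : Fin n → ℕ}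

theorem shiftWord_of_lt {i : Fin n} (h : i < rotationStart L D p) :
    shiftWord L D p w i = w i := by
  have hip : i < p := h.trans_le (rotationStart_spec L D p).1
  simp [shiftWord, rotate_of_lt h, hip.ne, not_lt.2 hip.le]

theorem shiftWord_start : shiftWord L D p w (rotationStart L D p) = below L (p + 1) := by
  have h := (rotationStart_spec L D p).1
  simp [shiftWord, rotate_start h, not_lt.2 h]

theorem shiftWord_succ {i j : Fin n} (hs : rotationStart L D p ≤ i) (hp : j ≤ p)
    (h : (j : ℕ) = i + 1) : shiftWord L D p w j = w i := by
  have : i ≠ p := by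
    rintro rfl
    rw [Fin.le_def] at hp
    omega
  simp [shiftWord, rotate_succ hs hp h, this, not_lt.2 hp]

theorem shiftWord_of_gt_of_mem {i : Fin n} (h : p < i) (hi : i ∈ L) :
    shiftWord L D p w i = w i := by
  simp [shiftWord, rotate_of_gt h, h.ne', hi]

theorem shiftWord_of_gt_of_notMem {i : Fin n} (h : p < i) (hi : i ∉ L) :
    shiftWord L D p w i = w i - 1 := by
  simp [shiftWord, rotate_of_gt h, h.ne', hi, h]

end shiftWord

namespace HasLeftmost

variable {L D : Finset (Fin n)} {p : Fin n} {w : Fin n → ℕ}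

theorem notMem_of_start_lt (h : HasLeftmost L w) (hD : AscSet w ⊆ D) {i : Fin n}
    (hs : rotationStart L D p < i) (hi : i ≤ p) : i ∉ L := by
  intro hiL
  rw [Fin.lt_def] at hs
  rw [Fin.le_def] at hi
  have hi1 : (i : ℕ) - 1 < n := by omega
  have hij : (i : ℕ) = (⟨i - 1, hi1⟩ : Fin n) + 1 := by simp only; omega
  refine (rotationStart_spec L D p).2.2 ⟨i - 1, hi1⟩ ?_ ?_
    (hD (h.pred_mem_ascSet hij hiL))
  · rw [Fin.le_def]
    simp only
    omega
  · rw [Fin.lt_def]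
    simp only
    omega

theorem below_start (h : HasLeftmost L w) (hD : AscSet w ⊆ D) {i : Fin n}
    (hs : rotationStart L D p ≤ i) (hi : i ≤ p) :
    below L (i + 1) = below L (rotationStart L D p + 1) := by
  obtain ⟨k, hk⟩ := i
  induction k with
  | zero =>
    rw [Fin.le_def] at hs
    simp only at hs
    congr 2
    simp only
    omega
  | succ k ih =>
    rcases eq_or_lt_of_le hs with e | hlt
    · rw [e]
    · have h1 := below_succ_of_notMem (h.notMem_of_start_lt hD hlt hi)
      rw [h1]
      rw [Fin.lt_def] at hlt
      rw [Fin.le_def] at hi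
      simp only at hlt hi
      refine ih (by omega) ?_ ?_
      · rw [Fin.le_def]
        simp only
        omega
      · rw [Fin.le_def]
        simp only
        omega

theorem shiftWord (h : HasLeftmost L w) (hD : AscSet w ⊆ D) (hp : IsLastOne w p) :
    HasLeftmost L (shiftWord L D p w) := by
  have key (i : Fin n) : 1 ≤ _root_.shiftWord L D p w i ∧
      _root_.shiftWord L D p w i ≤ below L (i + 1) ∧
      (i ∈ L → _root_.shiftWord L D p w i = below L (i + 1)) := by
    obtain ⟨hsp, hsL, -⟩ := rotationStart_spec L D p
    have hb := h.below_start hD hsp le_rfl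
    have h1 := h.pos i
    have h2 := h.le i
    have h3 := h.eq i
    rcases lt_trichotomy i (rotationStart L D p) with hlt | heq | hgt
    · rw [shiftWord_of_lt hlt]
      exact ⟨h1, h2, h3⟩
    · rw [heq, shiftWord_start, hb]
      rw [heq] at h1 h2
      exact ⟨h1.trans h2, le_rfl, fun _ => rfl⟩
    · rcases le_or_gt i p with hip | hip
      · have hi := h.notMem_of_start_lt hD hgt hip
        rw [Fin.lt_def] at hgt
        have hi1 : (i : ℕ) - 1 < n := by omega
        have hij : (i : ℕ) = (⟨i - 1, hi1⟩ : Fin n) + 1 := by simp only; omega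
        rw [shiftWord_succ (by rw [Fin.le_def]; simp only; omega) hip hij]
        have h4 := h.le ⟨i - 1, hi1⟩
        rw [← hij] at h4
        exact ⟨h.pos _, h4.trans (below_mono L (by omega)), fun hiL => absurd hiL hi⟩
      · by_cases hi : i ∈ L
        · rw [shiftWord_of_gt_of_mem hip hi]
          exact ⟨h1, h2, h3⟩
        · rw [shiftWord_of_gt_of_notMem hip hi]
          have := hp.2 i hip
          exact ⟨by omega, by omega, fun hiL => absurd hiL hi⟩
  exact ⟨h.zero_mem, fun i => (key i).1, fun i => (key i).2.1, fun i => (key i).2.2⟩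

theorem lastOne_mem (h : HasLeftmost L w) (hD : AscSet w ⊆ D) (hp : IsLastOne w p)
    {j : Fin n} (hj : p < j) : p ∈ D := by
  rw [Fin.lt_def] at hj
  have hp1 : (p : ℕ) + 1 < n := by omega
  refine hD ?_
  simp only [AscSet, mem_filter, mem_univ, true_and]
  refine ⟨⟨p + 1, hp1⟩, rfl, ?_⟩
  have h1 := hp.2 ⟨p + 1, hp1⟩ (by rw [Fin.lt_def]; simp)
  have h2 := h.pos ⟨p + 1, hp1⟩
  have := hp.1
  omega

theorem ascSet_shiftWord (h : HasLeftmost L w) (hD : AscSet w ⊆ D) (hp : IsLastOne w p) :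
    AscSet (_root_.shiftWord L D p w) ⊆ D := by
  have hdesc {i j : Fin n} (hij : (j : ℕ) = i + 1) (hi : i ∉ D) : w j ≤ w i := by
    by_contra hlt
    exact hi (hD (mem_filter.2 ⟨mem_univ i, j, hij, not_le.1 hlt⟩))
  intro i hi
  simp only [AscSet, mem_filter, mem_univ, true_and] at hi
  obtain ⟨j, hij, hlt⟩ := hi
  by_contra hiD
  obtain ⟨hsp, hsL, hsD⟩ := rotationStart_spec L D p
  have hb := h.below_start hD hsp le_rfl
  refine absurd hlt (not_lt.2 ?_)
  have hjL : j ∉ L := fun hj => hiD (hD (h.pred_mem_ascSet hij hj))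
  have hlt' : i < j := by rw [Fin.lt_def]; omega
  rcases lt_trichotomy j (rotationStart L D p) with hjs | hjs | hjs
  · rw [shiftWord_of_lt hjs, shiftWord_of_lt (hlt'.trans hjs)]
    exact hdesc hij hiD
  · have hiL := mem_of_succ_eq_rotationStart (hjs ▸ hij) hiD
    have his : i < rotationStart L D p := hjs ▸ hlt'
    rw [shiftWord_of_lt his, h.eq i hiL, hjs, shiftWord_start, hb, ← hjs,
      below_succ_of_notMem hjL, hij]
  · have hsi : rotationStart L D p ≤ i := by
      rw [Fin.lt_def] at hjs
      rw [Fin.le_def]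
      omega
    rcases le_or_gt j p with hjp | hjp
    · rw [shiftWord_succ hsi hjp hij]
      rcases eq_or_lt_of_le hsi with e | hsi'
      · rw [← e, shiftWord_start, hb]
        exact h.le _
      · rw [Fin.lt_def] at hsi'
        have hi1 : (i : ℕ) - 1 < n := by omega
        have hii : (i : ℕ) = (⟨i - 1, hi1⟩ : Fin n) + 1 := by simp only; omega
        have hsi1 : rotationStart L D p ≤ ⟨i - 1, hi1⟩ := by
          rw [Fin.le_def]
          simp only
          omega
        rw [shiftWord_succ hsi1 (hlt'.le.trans hjp) hii]
        refine hdesc hii (hsD _ hsi1 ?_)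
        rw [Fin.le_def] at hjp
        rw [Fin.lt_def]
        simp only
        omega
    · have hpi : p < i := by
        rw [Fin.lt_def] at hjp ⊢
        have : i ≠ p := by
          rintro rfl
          exact hiD (h.lastOne_mem hD hp hlt')
        have : (i : ℕ) ≠ p := fun e => this (Fin.ext e)
        omega
      have := hdesc hij hiD
      rw [shiftWord_of_gt_of_notMem hjp hjL]
      by_cases hiL : i ∈ L
      · rw [shiftWord_of_gt_of_mem hpi hiL]
        omega
      · rw [shiftWord_of_gt_of_notMem hpi hiL]
        omega

theorem ls_shiftWord (h : HasLeftmost L w) (hD : AscSet w ⊆ D) (hp : IsLastOne w p) :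
    ls (_root_.shiftWord L D p w) = vls w := by
  have hsp := (rotationStart_spec L D p).1
  have hterm (i : Fin n) : ((_root_.shiftWord L D p w i : ℕ) : ℤ) - 1 =
      (fun j => (w j : ℤ) - 1 + if j = p then (below L (p + 1) : ℤ) - 1 else 0)
        (rotate (rotationStart L D p) p i) - if p < i ∧ i ∉ L then 1 else 0 := by
    simp only [_root_.shiftWord]
    have hpos := h.pos (rotate (rotationStart L D p) p i)
    have h1 := hp.1
    by_cases hpi : p < i ∧ i ∉ L
    · have h2 := hp.2 i hpi.1
      rw [rotate_of_gt hpi.1] at *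
      simp only [hpi.1.ne', hpi, if_false, not_false_eq_true, and_self, if_true]
      omega
    · simp only [hpi, if_false]
      split_ifs with e
      · rw [e, h1]
        simp
      · simp
  have hcard : (#L : ℤ) = below L (p + 1) + ∑ i, if p < i ∧ i ∈ L then 1 else 0 := by
    have h1 : (below L (p + 1) : ℤ) = ∑ i, if i ≤ p ∧ i ∈ L then 1 else 0 := by
      rw [sum_boole, below]
      congr 1
      refine congrArg card ?_
      ext i
      simp only [mem_filter, mem_univ, true_and, Fin.le_def]
      constructor
      · exact fun hi => ⟨by omega, hi.1⟩
      · exact fun hi => ⟨hi.2, by omega⟩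
    have h2 : (#L : ℤ) = ∑ i, if i ∈ L then 1 else 0 := by simp
    rw [h1, h2, ← sum_add_distrib]
    refine sum_congr rfl fun i _ => ?_
    rcases le_or_gt i p with hi | hi
    · simp [hi, not_lt.2 hi]
    · simp [hi, not_le.2 hi]
  have hsplit : (∑ i, if p ≤ i then (1 : ℤ) else 0) =
      1 + (∑ i, if p < i ∧ i ∈ L then 1 else 0) + ∑ i, if p < i ∧ i ∉ L then 1 else 0 := by
    have h1 : (1 : ℤ) = ∑ i, if i = p then 1 else 0 := by simp
    conv_rhs => rw [h1]
    rw [← sum_add_distrib, ← sum_add_distrib]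
    refine sum_congr rfl fun i _ => ?_
    rcases lt_trichotomy i p with hi | hi | hi
    · simp [hi.ne, not_lt.2 hi.le, not_le.2 hi]
    · simp [hi]
    · by_cases hiL : i ∈ L <;> simp [hi, hi.le, hi.ne', hiL]
  have hmain := (h.shiftWord hD hp).ls_eq
  rw [sum_congr rfl fun i _ => hterm i, sum_sub_distrib,
    (rotate_bijective hsp).sum_comp (fun j => (w j : ℤ) - 1 +
      if j = p then (below L (p + 1) : ℤ) - 1 else 0), sum_add_distrib] at hmain
  have hvls := h.vls_eq hp
  have hone : (∑ j, if j = p then (below L (p + 1) : ℤ) - 1 else 0) = below L (p + 1) - 1 := by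
    simp
  rw [hone] at hmain
  rw [hsplit, hcard] at hvls
  have : (ls (_root_.shiftWord L D p w) : ℤ) = vls w := by
    rw [hmain, hvls]
    ring
  exact_mod_cast this

theorem not_lt_of_shiftWord_eq {w' : Fin n → ℕ} {p' : Fin n} (h : HasLeftmost L w)
    (h' : HasLeftmost L w') (hD : AscSet w ⊆ D) (hD' : AscSet w' ⊆ D) (hp : IsLastOne w p)
    (hp' : IsLastOne w' p')
    (e : _root_.shiftWord L D p w = _root_.shiftWord L D p' w') : ¬ p < p' := by
  intro hlt
  obtain ⟨hsp, hsL, hsD⟩ := rotationStart_spec L D p'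
  have hps : p < rotationStart L D p' := by
    by_contra hle
    exact hsD p (not_lt.1 hle) hlt (h.lastOne_mem hD hp hlt)
  have hsL' : rotationStart L D p' ∉ L := by
    rcases hsL with hsL | hsL
    · exact hsL
    · rw [hsL]
      intro hpL
      have h1 := h'.eq p' hpL
      have h2 := below_lt_of_mem hpL (k := p + 1) (by rw [Fin.lt_def] at hlt; omega)
      have h3 := h.le p
      have := hp'.1
      have := h.pos p
      omega
  have h1 := congrFun e (rotationStart L D p')
  rw [shiftWord_of_gt_of_notMem hps hsL', shiftWord_start, h'.below_start hD' hsp le_rfl] at h1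
  have h2 := h.le (rotationStart L D p')
  have h3 := h.pos (rotationStart L D p')
  omega

theorem eq_of_shiftWord_eq {w' : Fin n → ℕ} {p' : Fin n} (h : HasLeftmost L w)
    (h' : HasLeftmost L w') (hD : AscSet w ⊆ D) (hD' : AscSet w' ⊆ D) (hp : IsLastOne w p)
    (hp' : IsLastOne w' p')
    (e : _root_.shiftWord L D p w = _root_.shiftWord L D p' w') : w = w' := by
  obtain rfl : p = p' := le_antisymm
    (not_lt.1 (h'.not_lt_of_shiftWord_eq h hD' hD hp' hp e.symm))
    (not_lt.1 (h.not_lt_of_shiftWord_eq h' hD hD' hp hp' e))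
  funext j
  obtain ⟨i, rfl⟩ := (rotate_bijective (rotationStart_spec L D p).1).2 j
  have hi := congrFun e i
  simp only [_root_.shiftWord] at hi
  split_ifs at hi with h1 h2 h2
  · rw [h1, hp.1, hp'.1]
  · rw [h1, hp.1, hp'.1]
  · have := h.pos (rotate (rotationStart L D p) p i)
    have := h'.pos (rotate (rotationStart L D p) p i)
    omega
  · omega

end HasLeftmost

theorem finite_isRGF : Finite {w : Fin n → ℕ // IsRGF w} := by
  have hle (w : {w : Fin n → ℕ // IsRGF w}) (i : Fin n) : w.1 i < n + 1 := by
    have h1 := w.2.hasLeftmost.le i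
    have h2 : below (Lset w.1) (i + 1) ≤ #(univ : Finset (Fin n)) := by
      unfold below
      exact card_le_card (subset_univ _)
    rw [card_univ, Fintype.card_fin] at h2
    omega
  refine Finite.of_injective
    (fun w i => (⟨w.1 i, hle w i⟩ : Fin (n + 1)) : _ → (Fin n → Fin (n + 1))) ?_
  intro w w' e
  ext i
  simpa using congrFun e i

theorem exists_equiv_of_ascSet_subset (hn : 1 ≤ n) (D : Finset (Fin n)) :
    ∃ e : {x : {w : Fin n → ℕ // IsRGF w} // AscSet x.1 ⊆ D} ≃
        {x : {w : Fin n → ℕ // IsRGF w} // AscSet x.1 ⊆ D},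
      ∀ x, (Lset (e x).1.1, ls (e x).1.1) = (Lset x.1.1, vls x.1.1) := by
  have := finite_isRGF (n := n)
  choose p hp using fun x : {w : Fin n → ℕ // IsRGF w} => x.2.exists_isLastOne hn
  let f : {x : {w : Fin n → ℕ // IsRGF w} // AscSet x.1 ⊆ D} →
      {x : {w : Fin n → ℕ // IsRGF w} // AscSet x.1 ⊆ D} := fun x =>
    ⟨⟨shiftWord (Lset x.1.1) D (p x.1) x.1.1,
      (x.1.2.hasLeftmost.shiftWord x.2 (hp x.1)).isRGF⟩,
      x.1.2.hasLeftmost.ascSet_shiftWord x.2 (hp x.1)⟩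
  have hL x : Lset (f x).1.1 = Lset x.1.1 :=
    (x.1.2.hasLeftmost.shiftWord x.2 (hp x.1)).lset_eq
  have hf : Function.Injective f := by
    intro x y e
    have hxy : Lset x.1.1 = Lset y.1.1 := by rw [← hL x, e, hL y]
    have e' : shiftWord (Lset x.1.1) D (p x.1) x.1.1 =
        shiftWord (Lset y.1.1) D (p y.1) y.1.1 :=
      congrArg (fun z => z.1.1) e
    have hx := x.1.2.hasLeftmost
    rw [hxy] at e' hx
    exact Subtype.ext (Subtype.ext
      (hx.eq_of_shiftWord_eq y.1.2.hasLeftmost x.2 y.2 (hp x.1) (hp y.1) e'))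
  refine ⟨Equiv.ofBijective f (Finite.injective_iff_bijective.1 hf), fun x => ?_⟩
  exact Prod.ext (hL x) (x.1.2.hasLeftmost.ls_shiftWord x.2 (hp x.1))

/-- Möbius inversion over subsets: equidistribution on all the sets `a x ⊆ D` implies joint
equidistribution with `a`. -/
theorem exists_equiv_of_forall_subset {X α β : Type*} [Finite X] [DecidableEq α]
    (a : X → Finset α) (u v : X → β)
    (h : ∀ D, ∃ e : {x // a x ⊆ D} ≃ {x // a x ⊆ D}, ∀ x, v (e x).1 = u x.1) :
    ∃ ξ : X ≃ X, ∀ x, a (ξ x) = a x ∧ v (ξ x) = u x := by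
  classical
  have := Fintype.ofFinite X
  have hsub (D : Finset α) (y : β) :
      #{x : X | a x ⊆ D ∧ u x = y} = #{x : X | a x ⊆ D ∧ v x = y} := by
    obtain ⟨e, he⟩ := h D
    refine card_bij (fun x hx => (e ⟨x, (mem_filter.1 hx).2.1⟩).1) ?_ ?_ ?_
    · intro x hx
      refine mem_filter.2 ⟨mem_univ _, (e _).2, ?_⟩
      rw [he]
      exact (mem_filter.1 hx).2.2
    · intro x hx x' hx' hxx
      simpa using e.injective (Subtype.ext hxx)
    · intro x hx
      obtain ⟨-, hx1, hx2⟩ := mem_filter.1 hx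
      refine ⟨(e.symm ⟨x, hx1⟩).1, mem_filter.2 ⟨mem_univ _, (e.symm _).2, ?_⟩, by simp⟩
      rw [← he]
      simpa using hx2
  have hsum (D : Finset α) (t : X → β) (y : β) :
      #{x : X | a x ⊆ D ∧ t x = y} =
        ∑ E ∈ D.ssubsets, #{x : X | a x = E ∧ t x = y} + #{x : X | a x = D ∧ t x = y} := by
    rw [card_eq_sum_card_fiberwise (f := a) (t := D.powerset)
      (fun x hx => by simpa using (mem_filter.1 hx).2.1), ssubsets,
      ← sum_erase_add _ _ (mem_powerset_self D)]
    have hfib (E : Finset α) (hE : E ⊆ D) :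
        #{x ∈ ({x : X | a x ⊆ D ∧ t x = y} : Finset X) | a x = E} =
          #{x : X | a x = E ∧ t x = y} := by
      congr 1
      ext x
      simp only [mem_filter, mem_univ, true_and]
      constructor
      · exact fun hx => ⟨hx.2, hx.1.2⟩
      · exact fun hx => ⟨⟨hx.1 ▸ hE, hx.2⟩, hx.1⟩
    congr 1
    · exact sum_congr rfl fun E hE => hfib E (mem_powerset.1 (mem_of_mem_erase hE))
    · exact hfib D Subset.rfl
  have hexact (D : Finset α) : ∀ y,
      #{x : X | a x = D ∧ u x = y} = #{x : X | a x = D ∧ v x = y} := by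
    induction D using Finset.strongInduction with
    | H D ih =>
      intro y
      have h1 := hsub D y
      rw [hsum, hsum, sum_congr rfl fun E hE => ih E (mem_ssubsets.1 hE) y] at h1
      omega
  have hfiber (c : Finset α × β) :
      Nonempty ({x // (a x, u x) = c} ≃ {x // (a x, v x) = c}) := by
    refine Fintype.card_eq.1 ?_
    rw [Fintype.card_subtype, Fintype.card_subtype]
    simpa [Prod.ext_iff] using hexact c.1 c.2
  refine ⟨Equiv.ofFiberEquiv fun c => (hfiber c).some, fun x => ?_⟩
  have := Equiv.ofFiberEquiv_map (fun c => (hfiber c).some) x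
  exact Prod.ext_iff.1 this

/-- There is a bijection ξ on RG(n) preserving L and Asc and sending vls to ls. -/
theorem stmt10 (n : ℕ) (hn : 1 ≤ n) :
    ∃ ξ : {w : Fin n → ℕ // IsRGF w} ≃ {w : Fin n → ℕ // IsRGF w},
      ∀ w : {w : Fin n → ℕ // IsRGF w},
        Lset ((ξ w) : Fin n → ℕ) = Lset (w : Fin n → ℕ) ∧
        AscSet ((ξ w) : Fin n → ℕ) = AscSet (w : Fin n → ℕ) ∧
        ls ((ξ w) : Fin n → ℕ) = vls (w : Fin n → ℕ) := by
  have := finite_isRGF (n := n)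
  obtain ⟨ξ, hξ⟩ := exists_equiv_of_forall_subset
    (fun w : {w : Fin n → ℕ // IsRGF w} => AscSet w.1)
    (fun w => (Lset w.1, vls w.1)) (fun w => (Lset w.1, ls w.1))
    (exists_equiv_of_ascSet_subset hn)
  refine ⟨ξ, fun w => ?_⟩
  obtain ⟨h1, h2⟩ := hξ w
  exact ⟨(Prod.ext_iff.1 h2).1, h1, (Prod.ext_iff.1 h2).2⟩
end

section
/- The statistics (L, Asc, rs-vector) and (L, Asc, vrs-vector) have the same joint distribution over RGFs of length n: there is a bijection ζ on RG(n) with L(w) = L(ζ(w)), Asc(w) = Asc(ζ(w)), and rs_i(ζ(w)) = vrs_i(w) for every position i. -/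
open Finset

variable {n : ℕ}

/-- The number of positive elements of `T` below `w`. -/
def countBelow (T : Finset ℕ) (w : ℕ) : ℕ := (T ∩ Finset.Ico 1 w).card

lemma countBelow_mono (T : Finset ℕ) {u w : ℕ} (h : u ≤ w) : countBelow T u ≤ countBelow T w := by
  apply Finset.card_le_card
  intro t
  simp only [mem_inter, mem_Ico]
  exact fun ⟨h1, h2, h3⟩ => ⟨h1, h2, h3.trans_le h⟩

lemma countBelow_congr {T T' : Finset ℕ} {w : ℕ}
    (h : ∀ t, 1 ≤ t → t < w → (t ∈ T ↔ t ∈ T')) : countBelow T w = countBelow T' w := by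
  unfold countBelow
  congr 1
  ext t
  simp only [mem_inter, mem_Ico]
  constructor <;> rintro ⟨h1, h2, h3⟩
  · exact ⟨(h t h2 h3).1 h1, h2, h3⟩
  · exact ⟨(h t h2 h3).2 h1, h2, h3⟩

lemma countBelow_insert (T : Finset ℕ) (c w : ℕ) :
    countBelow (insert c T) w = countBelow T w + if c ∉ T ∧ 1 ≤ c ∧ c < w then 1 else 0 := by
  unfold countBelow
  by_cases h : 1 ≤ c ∧ c < w
  · rw [Finset.insert_inter_of_mem (by simpa using h)]
    by_cases hc : c ∈ T
    · rw [Finset.insert_eq_of_mem (by simp [hc, h])]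
      simp [hc]
    · rw [Finset.card_insert_of_notMem (by simp [hc])]
      simp [hc, h]
  · rw [Finset.insert_inter_of_notMem (by simpa using h)]
    have : ¬ (c ∉ T ∧ 1 ≤ c ∧ c < w) := fun h' => h h'.2
    simp [this]

lemma countBelow_succ (T : Finset ℕ) {w : ℕ} (hw : 1 ≤ w) :
    countBelow T (w + 1) = countBelow T w + if w ∈ T then 1 else 0 := by
  unfold countBelow
  rw [show Finset.Ico 1 (w + 1) = insert w (Finset.Ico 1 w) by ext; simp; omega]
  by_cases h : w ∈ T
  · rw [Finset.inter_insert_of_mem h, Finset.card_insert_of_notMem (by simp)]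
    simp [h]
  · rw [Finset.inter_insert_of_notMem h]
    simp [h]

/-- The letters of `[1, k]` with exactly `r` positive elements of `T` below them. -/
def letterBlock (T : Finset ℕ) (k r : ℕ) : Finset ℕ :=
  (Finset.Icc 1 k).filter fun w => countBelow T w = r

lemma mem_letterBlock {T : Finset ℕ} {k r w : ℕ} :
    w ∈ letterBlock T k r ↔ (1 ≤ w ∧ w ≤ k) ∧ countBelow T w = r := by
  simp [letterBlock]

lemma letterBlock_congr {T T' : Finset ℕ} {k : ℕ} (r : ℕ)
    (h : ∀ t, 1 ≤ t → t < k → (t ∈ T ↔ t ∈ T')) : letterBlock T k r = letterBlock T' k r := by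
  ext w
  simp only [mem_letterBlock]
  refine and_congr_right fun hw => ?_
  rw [countBelow_congr fun t h1 h2 => h t h1 (by omega)]

lemma letterBlock_eq_Icc {T : Finset ℕ} {k r : ℕ} (h : (letterBlock T k r).Nonempty) :
    ∃ lo hi, letterBlock T k r = Finset.Icc lo hi ∧ 1 ≤ lo ∧ lo ≤ hi ∧ hi ≤ k ∧
      (lo - 1 = 0 ∨ lo - 1 ∈ T) ∧ (hi = k ∨ hi ∈ T) ∧ ∀ t, lo ≤ t → t < hi → t ∉ T := by
  have h1 := mem_letterBlock.1 (Finset.min'_mem _ h)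
  have h2 := mem_letterBlock.1 (Finset.max'_mem _ h)
  have h3 : ∀ x ∈ letterBlock T k r, (letterBlock T k r).min' h ≤ x := fun x hx => Finset.min'_le _ x hx
  have h4 : ∀ x ∈ letterBlock T k r, x ≤ (letterBlock T k r).max' h := fun x hx => Finset.le_max' _ x hx
  generalize (letterBlock T k r).min' h = lo at *
  generalize (letterBlock T k r).max' h = hi at *
  have hle : lo ≤ hi := h3 _ (mem_letterBlock.2 h2)
  have hN : ∀ w, lo ≤ w → w ≤ hi → countBelow T w = r := fun w hw hw' =>
    le_antisymm (h2.2 ▸ countBelow_mono T hw') (h1.2 ▸ countBelow_mono T hw)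
  refine ⟨lo, hi, ?_, h1.1.1, hle, h2.1.2, ?_, ?_, ?_⟩
  · ext w
    rw [Finset.mem_Icc]
    refine ⟨fun hw => ⟨h3 w hw, h4 w hw⟩, fun hw => mem_letterBlock.2 ⟨by omega, hN w hw.1 hw.2⟩⟩
  · by_contra! hc
    have hs := countBelow_succ T (w := lo - 1) (by omega)
    rw [if_neg hc.2, Nat.sub_add_cancel h1.1.1, h1.2] at hs
    have := h3 (lo - 1) (mem_letterBlock.2 ⟨by omega, by omega⟩)
    omega
  · by_contra! hc
    have hs := countBelow_succ T (w := hi) (by omega)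
    rw [if_neg hc.2, h2.2] at hs
    have := h4 (hi + 1) (mem_letterBlock.2 ⟨by omega, by omega⟩)
    omega
  · intro t ht ht' hT
    have hs := countBelow_succ T (w := t) (by omega)
    rw [if_pos hT, hN t ht (by omega), hN (t + 1) (by omega) (by omega)] at hs
    omega

lemma sum_letterBlock_insert (T : Finset ℕ) (k r : ℕ) (φ : Finset ℕ → ℕ)
    (hφ : ∀ T T', (∀ t, 1 ≤ t → t < k → (t ∈ T ↔ t ∈ T')) → φ T = φ T') :
    ∑ w ∈ letterBlock T k r, φ (insert w T) = ∑ w ∈ letterBlock T k r, φ (insert (w - 1) T) := by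
  rcases (letterBlock T k r).eq_empty_or_nonempty with h | h
  · simp [h]
  obtain ⟨lo, hi, hB, h1, hle, hk, hlo, hhi, -⟩ := letterBlock_eq_Icc h
  rw [hB, ← Finset.Ico_insert_right hle, Finset.sum_insert (by simp), Finset.Ico_insert_right hle,
    ← Finset.Ioc_insert_left hle, Finset.sum_insert (by simp)]
  congr 1
  · refine hφ _ _ fun t ht htk => ?_
    simp only [Finset.mem_insert]
    grind
  · refine Finset.sum_bij' (fun w _ => w + 1) (fun w _ => w - 1) ?_ ?_ ?_ ?_ ?_ <;>
      simp only [Finset.mem_Ico, Finset.mem_Ioc] <;> intros <;> try omega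
    simp

/-- Words `x` of length `m` whose leftmost occurrences are prescribed by `L`, ascents by `A`, and
right statistic by `v`; here `a` is the letter following `x`, and `T` is the set of letters
following `x`, each lowered by `s`. -/
def words (s : ℕ) (L A : Finset ℕ) (v : ℕ → ℕ) : (m : ℕ) → Finset ℕ → ℕ → Finset (Fin m → ℕ)
  | 0, _, _ => Finset.univ
  | m + 1, T, a =>
    ((Finset.Icc 1 (Nat.count (· ∈ L) (m + 1))).filter fun w =>
      (m ∈ L → w = Nat.count (· ∈ L) (m + 1)) ∧ countBelow T w = v m ∧ (m ∈ A ↔ w < a)).biUnion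
      fun w => (words s L A v m (insert (w - s) T) w).image fun x => (Fin.snoc x w : Fin (m + 1) → ℕ)

lemma card_words_succ (s : ℕ) (L A : Finset ℕ) (v : ℕ → ℕ) (m : ℕ) (T : Finset ℕ) (a : ℕ) :
    (words s L A v (m + 1) T a).card =
      ∑ w ∈ (Finset.Icc 1 (Nat.count (· ∈ L) (m + 1))).filter fun w =>
      (m ∈ L → w = Nat.count (· ∈ L) (m + 1)) ∧ countBelow T w = v m ∧ (m ∈ A ↔ w < a),
      (words s L A v m (insert (w - s) T) w).card := by
  rw [words, Finset.card_biUnion]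
  · refine Finset.sum_congr rfl fun w _ => Finset.card_image_of_injective _ fun x y h => ?_
    simpa using congrArg (Fin.init (α := fun _ => ℕ)) h
  · intro w _ w' _ hne
    rw [Function.onFun, Finset.disjoint_left]
    rintro z hz hz'
    obtain ⟨x, -, rfl⟩ := Finset.mem_image.1 hz
    obtain ⟨y, -, hy⟩ := Finset.mem_image.1 hz'
    have := congrFun hy (Fin.last m)
    simp only [Fin.snoc_last] at this
    exact hne this.symm

lemma card_words_congr (s : ℕ) (L A : Finset ℕ) (v : ℕ → ℕ) (m : ℕ) (T T' : Finset ℕ) (a : ℕ)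
    (h : ∀ t, 1 ≤ t → t < Nat.count (· ∈ L) m → (t ∈ T ↔ t ∈ T')) :
    (words s L A v m T a).card = (words s L A v m T' a).card := by
  induction m generalizing T T' a with
  | zero => rfl
  | succ m ih =>
    rw [card_words_succ, card_words_succ]
    refine Finset.sum_congr (Finset.filter_congr fun w hw => ?_) fun w _ => ih _ _ _ fun t h1 h2 => ?_
    · rw [Finset.mem_Icc] at hw
      rw [countBelow_congr fun t h1 h2 => h t h1 (by omega)]
    · have := Nat.count_monotone (· ∈ L) (Nat.le_succ m)
      simp only [Finset.mem_insert, h t h1 (h2.trans_le this)]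

lemma card_words_succ_of_notMem (s : ℕ) {L : Finset ℕ} (A : Finset ℕ) (v : ℕ → ℕ) {m : ℕ}
    (hm : m ∉ L) (T : Finset ℕ) (a : ℕ) :
    (words s L A v (m + 1) T a).card =
      ∑ w ∈ (letterBlock T (Nat.count (· ∈ L) m) (v m)).filter fun w => m ∈ A ↔ w < a,
        (words s L A v m (insert (w - s) T) w).card := by
  rw [card_words_succ, letterBlock, Finset.filter_filter]
  simp [Nat.count_succ, hm]

lemma card_words_succ_of_mem {s : ℕ} (hs : s ≤ 1) {L : Finset ℕ} (A : Finset ℕ) (v : ℕ → ℕ) {m : ℕ}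
    (hm : m ∈ L) (T : Finset ℕ) (a : ℕ) :
    (words s L A v (m + 1) T a).card =
      if countBelow T (Nat.count (· ∈ L) m + 1) = v m ∧ (m ∈ A ↔ Nat.count (· ∈ L) m + 1 < a)
      then (words s L A v m T (Nat.count (· ∈ L) m + 1)).card else 0 := by
  have hc : Nat.count (· ∈ L) (m + 1) = Nat.count (· ∈ L) m + 1 := by simp [Nat.count_succ, hm]
  rw [card_words_succ, hc]
  generalize hk : Nat.count (· ∈ L) m = k
  have hcongr : (words s L A v m (insert (k + 1 - s) T) (k + 1)).card =
      (words s L A v m T (k + 1)).card := by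
    refine card_words_congr _ _ _ _ _ _ _ _ fun t h1 h2 => ?_
    rw [Finset.mem_insert]
    exact ⟨fun h => h.resolve_left (by omega), Or.inr⟩
  split_ifs with h
  · rw [← hcongr, ← Finset.sum_singleton (fun w => (words s L A v m (insert (w - s) T) w).card)]
    refine Finset.sum_congr ?_ fun _ _ => rfl
    ext w
    simp only [Finset.mem_filter, Finset.mem_Icc, Finset.mem_singleton, hm, true_implies]
    constructor
    · exact fun h => h.2.1
    · rintro rfl
      exact ⟨by omega, rfl, h⟩
  · refine Finset.sum_eq_zero fun w hw => absurd ?_ h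
    simp only [Finset.mem_filter, hm, true_implies] at hw
    obtain ⟨-, rfl, hw⟩ := hw
    exact hw

lemma sum_letterBlock_card_words_congr (s : ℕ) (L A : Finset ℕ) (v : ℕ → ℕ) (m r : ℕ)
    {T T' : Finset ℕ} (h : ∀ t, 1 ≤ t → t < Nat.count (· ∈ L) m → (t ∈ T ↔ t ∈ T')) :
    ∑ w ∈ letterBlock T (Nat.count (· ∈ L) m) r, (words s L A v m (insert (w - s) T) w).card =
      ∑ w ∈ letterBlock T' (Nat.count (· ∈ L) m) r,
        (words s L A v m (insert (w - s) T') w).card := by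
  refine Finset.sum_congr (letterBlock_congr r h) fun w _ =>
    card_words_congr _ _ _ _ _ _ _ _ fun t h1 h2 => ?_
  simp only [Finset.mem_insert, h t h1 h2]

lemma card_words_eq_of_lt_or_eq_zero {L A : Finset ℕ} {v : ℕ → ℕ} {m : ℕ}
    (ih : ∀ m' < m, ∀ T r,
      ∑ w ∈ letterBlock T (Nat.count (· ∈ L) m') r, (words 0 L A v m' (insert (w - 0) T) w).card =
      ∑ w ∈ letterBlock T (Nat.count (· ∈ L) m') r, (words 1 L A v m' (insert (w - 1) T) w).card)
    (T : Finset ℕ) {a : ℕ} (ha : Nat.count (· ∈ L) m < a ∨ a = 0) :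
    (words 0 L A v m T a).card = (words 1 L A v m T a).card := by
  induction m generalizing T a with
  | zero => rfl
  | succ m ihm =>
    by_cases hm : m ∈ L
    · rw [card_words_succ_of_mem (by omega) _ _ hm, card_words_succ_of_mem (by omega) _ _ hm,
        ihm (fun m' h => ih m' (by omega)) T (Or.inl (Nat.lt_succ_self _))]
    · rw [card_words_succ_of_notMem _ _ _ hm, card_words_succ_of_notMem _ _ _ hm]
      have hc : Nat.count (· ∈ L) (m + 1) = Nat.count (· ∈ L) m := by simp [Nat.count_succ, hm]
      rw [hc] at ha
      have key : ∀ w ∈ letterBlock T (Nat.count (· ∈ L) m) (v m),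
          (m ∈ A ↔ w < a) ↔ (m ∈ A ↔ a ≠ 0) := by
        intro w hw
        have := (mem_letterBlock.1 hw).1
        have : w < a ↔ a ≠ 0 := by omega
        rw [this]
      rw [Finset.filter_congr key, Finset.filter_const]
      split_ifs
      · exact ih m (by omega) T _
      · rfl

lemma sum_letterBlock_card_words (L A : Finset ℕ) (v : ℕ → ℕ) (m : ℕ) (T : Finset ℕ) (r : ℕ) :
    ∑ w ∈ letterBlock T (Nat.count (· ∈ L) m) r, (words 0 L A v m (insert (w - 0) T) w).card =
      ∑ w ∈ letterBlock T (Nat.count (· ∈ L) m) r,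
        (words 1 L A v m (insert (w - 1) T) w).card := by
  induction m using Nat.strong_induction_on generalizing T r with
  | _ m ih =>
  rcases m with - | m
  · rfl
  by_cases hm : m ∈ L
  · have hc : Nat.count (· ∈ L) (m + 1) = Nat.count (· ∈ L) m + 1 := by simp [Nat.count_succ, hm]
    simp only [card_words_succ_of_mem (le_refl 1) _ _ hm,
      card_words_succ_of_mem (Nat.zero_le 1) _ _ hm, Nat.sub_zero]
    have hZ : ∀ T, (words 1 L A v m T (Nat.count (· ∈ L) m + 1)).card =
        (words 0 L A v m T (Nat.count (· ∈ L) m + 1)).card := fun T =>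
      (card_words_eq_of_lt_or_eq_zero (fun m' h => ih m' (by omega)) T
        (Or.inl (Nat.lt_succ_self _))).symm
    simp only [hZ]
    have hasc : ∀ w ∈ letterBlock T (Nat.count (· ∈ L) (m + 1)) r,
        ¬ (Nat.count (· ∈ L) m + 1 < w) := by
      intro w hw
      have := (mem_letterBlock.1 hw).1
      omega
    have hφ := sum_letterBlock_insert T (Nat.count (· ∈ L) (m + 1)) r
      (fun T => if countBelow T (Nat.count (· ∈ L) m + 1) = v m ∧ (m ∈ A ↔ False)
        then (words 0 L A v m T (Nat.count (· ∈ L) m + 1)).card else 0) (by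
        intro T T' h
        rw [hc] at h
        simp only [countBelow_congr h]
        rw [card_words_congr _ _ _ _ _ _ _ _ fun t h1 h2 => h t h1 (by omega)])
    refine Eq.trans (Finset.sum_congr rfl fun w hw => ?_)
      (hφ.trans (Finset.sum_congr rfl fun w hw => ?_)) <;> simp only [hasc w hw]
  have hc : Nat.count (· ∈ L) (m + 1) = Nat.count (· ∈ L) m := by simp [Nat.count_succ, hm]
  have ihm := ih m (Nat.lt_succ_self m)
  have hcongr := fun r (T T' : Finset ℕ) =>
    sum_letterBlock_card_words_congr 0 L A v m r (T := T) (T' := T')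
  have hcongr1 := fun r (T T' : Finset ℕ) =>
    sum_letterBlock_card_words_congr 1 L A v m r (T := T) (T' := T')
  have hw0 := fun T T' a => card_words_congr 0 L A v m T T' a
  simp only [card_words_succ_of_notMem _ _ _ hm, hc]
  generalize Nat.count (· ∈ L) m = k at *
  generalize v m = r' at *
  by_cases hr : r' = r
  · subst hr
    rcases (letterBlock T k r').eq_empty_or_nonempty with h | h
    · simp [h]
    obtain ⟨lo, hi, hB, h1, hle, hk, hlo, hhi, hnot⟩ := letterBlock_eq_Icc h
    have hmem : ∀ w, ((1 ≤ w ∧ w ≤ k) ∧ countBelow T w = r') ↔ lo ≤ w ∧ w ≤ hi := fun w => by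
      rw [← mem_letterBlock, hB, Finset.mem_Icc]
    by_cases hA : m ∈ A
    · have hX : ∀ s ≤ 1, ∀ w ∈ Finset.Icc lo hi,
          (letterBlock (insert (w - s) T) k r').filter (fun u => m ∈ A ↔ u < w) =
            Finset.Ico lo w := by
        intro s hs w hw
        rw [Finset.mem_Icc] at hw
        ext u
        simp only [Finset.mem_filter, mem_letterBlock, hA, true_iff, Finset.mem_Ico,
          countBelow_insert]
        constructor
        · rintro ⟨⟨h3, h4⟩, h5⟩
          rw [if_neg (by omega)] at h4
          exact ⟨((hmem u).1 ⟨h3, h4⟩).1, h5⟩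
        · rintro ⟨h3, h4⟩
          have := (hmem u).2 ⟨h3, by omega⟩
          rw [if_neg (by omega)]
          exact ⟨this, h4⟩
      rw [hB, Finset.sum_congr rfl fun w hw => Finset.sum_congr (hX 0 (by omega) w hw) fun _ _ => rfl,
        Finset.sum_congr rfl fun w hw => Finset.sum_congr (hX 1 (by omega) w hw) fun _ _ => rfl]
      have hblock : ∀ c, lo ≤ c → c < hi → letterBlock (insert c T) k r' = Finset.Icc lo c := by
        intro c hc1 hc2
        ext u
        rw [mem_letterBlock, countBelow_insert, Finset.mem_Icc]
        have hcT := hnot c hc1 hc2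
        constructor
        · rintro ⟨h3, h4⟩
          by_cases hcu : c < u
          · have h5 := ((hmem c).2 ⟨hc1, hc2.le⟩).2
            have h6 := countBelow_mono T hcu.le
            rw [if_pos ⟨hcT, by omega⟩] at h4
            omega
          · rw [if_neg (by omega)] at h4
            have := (hmem u).1 ⟨h3, h4⟩
            omega
        · rintro ⟨h3, h4⟩
          rw [if_neg (by omega)]
          exact (hmem u).2 ⟨h3, by omega⟩
      have hR : ∀ c ∈ Finset.Ico lo hi,
          ∑ u ∈ Finset.Ico lo (c + 1), (words 1 L A v m (insert (u - 1) (insert c T)) u).card =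
          (words 0 L A v m (insert c T) c).card +
          ∑ u ∈ Finset.Ico lo c, (words 0 L A v m (insert (u - 0) (insert c T)) u).card := by
        intro c hc
        rw [Finset.mem_Ico] at hc
        have h3 := ihm (insert c T) r'
        rw [hblock c hc.1 hc.2] at h3
        rw [show Finset.Ico lo (c + 1) = Finset.Icc lo c by ext; simp, ← h3, ← Finset.Ico_insert_right hc.1,
          Finset.sum_insert (by simp)]
        simp
      rw [← Finset.Ico_insert_right hle, Finset.sum_insert (by simp), Finset.Ico_insert_right hle,
        ← Finset.Ioc_insert_left hle, Finset.sum_insert (by simp), Finset.Ico_self,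
        Finset.sum_empty, zero_add]
      trans ∑ c ∈ Finset.Ico lo hi, ∑ u ∈ Finset.Ico lo (c + 1),
        (words 1 L A v m (insert (u - 1) (insert c T)) u).card
      · rw [Finset.sum_congr rfl hR, Finset.sum_add_distrib]
        congr 1
        refine Finset.sum_congr rfl fun u _ => hw0 _ _ _ fun t ht htk => ?_
        simp only [Finset.mem_insert]
        grind
      · refine Finset.sum_bij' (fun w _ => w + 1) (fun w _ => w - 1) ?_ ?_ ?_ ?_ ?_ <;>
          simp only [Finset.mem_Ico, Finset.mem_Ioc] <;> intros <;> try omega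
        simp
    · have hX : ∀ w ∈ letterBlock T k r',
          (letterBlock (insert (w - 0) T) k r').filter (fun u => m ∈ A ↔ u < w) = {w} := by
        intro w hw
        rw [mem_letterBlock] at hw
        ext u
        simp only [Finset.mem_filter, mem_letterBlock, hA, false_iff, Finset.mem_singleton,
          countBelow_insert, Nat.sub_zero]
        constructor
        · rintro ⟨⟨h3, h4⟩, h5⟩
          by_contra hne
          have h6 := countBelow_mono T (show w + 1 ≤ u by omega)
          rw [countBelow_succ T hw.1.1] at h6
          by_cases hT : w ∈ T
          · simp only [hT, if_true] at h6
            omega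
          · rw [if_neg hT] at h6
            rw [if_pos ⟨hT, by omega⟩] at h4
            omega
        · rintro rfl
          simp [hw]
      rw [Finset.sum_congr rfl fun w hw => Finset.sum_congr (hX w hw) fun _ _ => rfl]
      simp only [Finset.sum_singleton, Finset.insert_idem]
      rw [ihm T r']
      have hY : ∀ w ∈ letterBlock T k r', w ≠ lo →
          (letterBlock (insert (w - 1) T) k r').filter (fun u => m ∈ A ↔ u < w) = ∅ := by
        intro w hw hne
        rw [hB, Finset.mem_Icc] at hw
        rw [Finset.filter_eq_empty_iff]
        intro u hu hc
        rw [mem_letterBlock, countBelow_insert, if_pos ⟨hnot _ (by omega) (by omega), by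
          simp only [hA, false_iff] at hc; omega⟩] at hu
        simp only [hA, false_iff] at hc
        have h6 := countBelow_mono T (show w ≤ u by omega)
        rw [((hmem w).2 hw).2] at h6
        omega
      rw [Finset.sum_eq_single_of_mem (f := fun w => ∑ u ∈ _, _) lo (by rw [hB]; simp [hle])
        fun w hw hne => by rw [hY w hw hne, Finset.sum_empty]]
      have hT : ∀ t, 1 ≤ t → t < k → (t ∈ insert (lo - 1) T ↔ t ∈ T) := by
        intro t ht _
        rw [Finset.mem_insert]
        grind
      rw [Finset.filter_true_of_mem, hcongr1 r' _ _ hT]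
      intro u hu
      rw [letterBlock_congr r' hT, hB, Finset.mem_Icc] at hu
      simp only [hA, false_iff]
      omega
  · have hX : ∀ s ≤ 1, ∀ w ∈ letterBlock T k r,
        (letterBlock (insert (w - s) T) k r').filter (fun u => m ∈ A ↔ u < w) =
        (letterBlock (insert (w - s) T) k r').filter (fun _ => m ∈ A ↔ r' < r) := by
      intro s hs w hw
      refine Finset.filter_congr fun u hu => ?_
      rw [mem_letterBlock] at hw hu
      rw [countBelow_insert] at hu
      have : u < w ↔ r' < r := by
        constructor
        · intro h
          have := countBelow_mono T h.le
          rw [if_neg (by omega)] at hu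
          omega
        · intro h
          by_contra! h'
          have := countBelow_mono T h'
          omega
      rw [this]
    rw [Finset.sum_congr rfl fun w hw => Finset.sum_congr (hX 0 (by omega) w hw) fun _ _ => rfl,
      Finset.sum_congr rfl fun w hw => Finset.sum_congr (hX 1 (by omega) w hw) fun _ _ => rfl]
    simp only [Finset.filter_const]
    split_ifs
    · simp only [← ihm]
      exact sum_letterBlock_insert T k r (fun T => ∑ w ∈ letterBlock T k r',
        (words 0 L A v m (insert (w - 0) T) w).card) fun T T' h => hcongr r' T T' h
    · simp

lemma card_words_shift_eq (L A : Finset ℕ) (v : ℕ → ℕ) (m : ℕ) (T : Finset ℕ) :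
    (words 0 L A v m T 0).card = (words 1 L A v m T 0).card :=
  card_words_eq_of_lt_or_eq_zero (fun m' _ => sum_letterBlock_card_words L A v m') T (Or.inr rfl)

lemma mem_words {s : ℕ} {L A : Finset ℕ} {v : ℕ → ℕ} {m : ℕ} {T : Finset ℕ} {a : ℕ}
    {x : Fin m → ℕ} :
    x ∈ words s L A v m T a ↔ ∀ i : Fin m,
      (1 ≤ x i ∧ x i ≤ Nat.count (· ∈ L) (i + 1)) ∧
      ((i : ℕ) ∈ L → x i = Nat.count (· ∈ L) (i + 1)) ∧
      countBelow (T ∪ (Finset.Ioi i).image fun j => x j - s) (x i) = v i ∧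
      ((i : ℕ) ∈ A ↔ x i < if h : (i : ℕ) + 1 < m then x ⟨i + 1, h⟩ else a) := by
  induction m generalizing T a with
  | zero => simp only [words, Finset.mem_univ, IsEmpty.forall_iff]
  | succ m ih =>
    induction x using Fin.snocCases with
    | snoc x w =>
    have hmem : (Fin.snoc x w : Fin (m + 1) → ℕ) ∈ words s L A v (m + 1) T a ↔
        ((1 ≤ w ∧ w ≤ Nat.count (· ∈ L) (m + 1)) ∧ (m ∈ L → w = Nat.count (· ∈ L) (m + 1)) ∧
          countBelow T w = v m ∧ (m ∈ A ↔ w < a)) ∧ x ∈ words s L A v m (insert (w - s) T) w := by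
      simp only [words, Finset.mem_biUnion, Finset.mem_filter, Finset.mem_Icc, Finset.mem_image]
      constructor
      · rintro ⟨w', hw', y, hy, h⟩
        obtain ⟨rfl, rfl⟩ := Fin.snoc_injective2 h
        exact ⟨hw', hy⟩
      · rintro ⟨hw, hx⟩
        exact ⟨w, hw, x, hx, rfl⟩
    rw [hmem, ih, Fin.forall_fin_succ', and_comm]
    refine and_congr (forall_congr' fun i => ?_) ?_
    · have himg : T ∪ (Finset.Ioi i.castSucc).image (fun j => (Fin.snoc x w : Fin (m + 1) → ℕ) j - s) =
          insert (w - s) T ∪ (Finset.Ioi i).image fun j => x j - s := by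
        ext t
        simp only [Finset.mem_union, Finset.mem_image, Finset.mem_Ioi, Finset.mem_insert,
          Fin.exists_fin_succ', Fin.snoc_castSucc, Fin.snoc_last, Fin.castSucc_lt_castSucc_iff,
          Fin.castSucc_lt_last, true_and, eq_comm (a := t)]
        rw [or_assoc, or_comm (a := t ∈ T), or_left_comm, or_comm (a := t ∈ T),
          or_comm (a := w - s = t)]
      have hnext : (if h : (i.castSucc : ℕ) + 1 < m + 1
          then (Fin.snoc x w : Fin (m + 1) → ℕ) ⟨i.castSucc + 1, h⟩ else a) =
          if h : (i : ℕ) + 1 < m then x ⟨i + 1, h⟩ else w := by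
        rw [dif_pos (by simp)]
        simp [Fin.snoc]
      rw [himg, hnext]
      simp
    · have himg : (Finset.Ioi (Fin.last m)) = ∅ := by
        ext j
        simp [Fin.le_last]
      simp [himg]

lemma image_filter_val_lt_succ (w : Fin n → ℕ) (i : Fin n) :
    (Finset.univ.filter fun j : Fin n => (j : ℕ) < i + 1).image w =
      insert (w i) ((Finset.univ.filter fun j : Fin n => (j : ℕ) < i).image w) := by
  rw [← Finset.image_insert]
  congr 1
  ext j
  simp [Fin.ext_iff]
  omega

lemma image_filter_eq_Icc_of_isRGF {w : Fin n → ℕ} (hw : IsRGF w) {m : ℕ} (hm : m ≤ n) :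
    (Finset.univ.filter fun j : Fin n => (j : ℕ) < m).image w =
      Finset.Icc 1 (Nat.count (· ∈ (Lset w).map Fin.valEmbedding) m) := by
  induction m with
  | zero => simp
  | succ m ih =>
    have ih := ih (by omega)
    have hi := image_filter_val_lt_succ w ⟨m, hm⟩
    have hmem : m ∈ (Lset w).map Fin.valEmbedding ↔ w ⟨m, hm⟩ ∉
        (Finset.univ.filter fun j : Fin n => (j : ℕ) < m).image w := by
      simp only [Lset, Finset.mem_map, Finset.mem_filter, Finset.mem_univ, true_and,
        Finset.mem_image, Fin.valEmbedding_apply]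
      constructor
      · rintro ⟨i, hi', rfl⟩ ⟨j, hj, h⟩
        exact hi' j hj h
      · intro h
        exact ⟨⟨m, hm⟩, fun j hj hjw => h ⟨j, hj, hjw⟩, rfl⟩
    simp only at hi
    rw [hi, Nat.count_succ, ih]
    rw [ih] at hmem
    have hle : w ⟨m, hm⟩ ≤ Nat.count (· ∈ (Lset w).map Fin.valEmbedding) m + 1 := by
      rcases Nat.eq_zero_or_pos m with rfl | hpos
      · rw [hw.2.1 ⟨0, hm⟩ rfl]
        omega
      · refine (hw.2.2 ⟨m, hm⟩ hpos).trans (Nat.succ_le_succ (Finset.sup_le fun j hj => ?_))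
        have : w j ∈ Finset.Icc 1 (Nat.count (· ∈ (Lset w).map Fin.valEmbedding) m) := by
          rw [← ih]
          refine Finset.mem_image_of_mem _ ?_
          simpa [Fin.lt_def] using hj
        exact (Finset.mem_Icc.1 this).2
    have hpos := hw.1 ⟨m, hm⟩
    ext t
    rw [Finset.mem_Icc] at hmem
    simp only [Finset.mem_insert, Finset.mem_Icc]
    split_ifs with h
    · rw [hmem] at h
      omega
    · rw [hmem] at h
      omega

/-- A word is an RGF with leftmost occurrences `L` iff the letters at `L` are successive new
maxima, and all others are bounded by the current maximum. -/
lemma isRGF_and_Lset_eq_iff (w : Fin n → ℕ) (L : Finset (Fin n)) :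
    IsRGF w ∧ Lset w = L ↔ ∀ i : Fin n,
      (1 ≤ w i ∧ w i ≤ Nat.count (· ∈ L.map Fin.valEmbedding) (i + 1)) ∧
      ((i : ℕ) ∈ L.map Fin.valEmbedding →
        w i = Nat.count (· ∈ L.map Fin.valEmbedding) (i + 1)) := by
  constructor
  · rintro ⟨hw, rfl⟩ i
    have h1 := image_filter_eq_Icc_of_isRGF hw (m := i + 1) i.isLt
    have h0 := image_filter_eq_Icc_of_isRGF hw (m := i) i.isLt.le
    have hi : w i ∈ Finset.Icc 1
        (Nat.count (· ∈ (Lset w).map Fin.valEmbedding) (i + 1)) := by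
      rw [← h1, image_filter_val_lt_succ]
      exact Finset.mem_insert_self _ _
    rw [Finset.mem_Icc] at hi
    refine ⟨hi, fun hL => ?_⟩
    have hn : w i ∉ Finset.Icc 1 (Nat.count (· ∈ (Lset w).map Fin.valEmbedding) i) := by
      rw [← h0]
      simp only [Lset, Finset.mem_map, Finset.mem_filter, Finset.mem_univ, true_and,
        Finset.mem_image, Fin.valEmbedding_apply] at hL ⊢
      rintro ⟨j, hj, h⟩
      obtain ⟨i', hi', hii⟩ := hL
      obtain rfl := Fin.ext hii
      exact hi' j hj h
    rw [Finset.mem_Icc] at hn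
    rw [Nat.count_succ, if_pos hL] at hi ⊢
    omega
  · intro h
    have hcount : ∀ i : Fin n, Nat.count (· ∈ L.map Fin.valEmbedding) (i + 1) =
        Nat.count (· ∈ L.map Fin.valEmbedding) i + if i ∈ L then 1 else 0 := by
      intro i
      rw [Nat.count_succ]
      simp [Fin.val_inj]
    have hmapi : ∀ i : Fin n, (i : ℕ) ∈ L.map Fin.valEmbedding ↔ i ∈ L := by
      intro i
      simp [Fin.val_inj]
    simp only [hcount, hmapi] at h
    have himg : ∀ m ≤ n, (Finset.univ.filter fun j : Fin n => (j : ℕ) < m).image w =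
        Finset.Icc 1 (Nat.count (· ∈ L.map Fin.valEmbedding) m) := by
      intro m hm
      induction m with
      | zero => simp
      | succ m ih =>
        have hi := image_filter_val_lt_succ w ⟨m, hm⟩
        have hc := hcount ⟨m, hm⟩
        have hm' := h ⟨m, hm⟩
        simp only at hi hc hm'
        rw [hi, ih (by omega), hc]
        ext t
        simp only [Finset.mem_insert, Finset.mem_Icc]
        split_ifs at hm' ⊢ with hL
        · have := hm'.2 hL
          omega
        · omega
    have hmem : ∀ i : Fin n, i ∈ Lset w ↔ i ∈ L := by
      intro i
      have h1 : i ∈ Lset w ↔ w i ∉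
          (Finset.univ.filter fun j : Fin n => (j : ℕ) < i).image w := by
        simp only [Lset, Finset.mem_filter, Finset.mem_univ, true_and, Finset.mem_image, not_exists,
          not_and, Fin.lt_def, ne_eq]
      rw [h1, himg i i.isLt.le, Finset.mem_Icc]
      have := h i
      split_ifs at this with hL
      · have := this.2 hL
        simp only [hL, iff_true]
        omega
      · simp only [hL, iff_false]
        omega
    refine ⟨⟨fun i => (h i).1.1, fun i hi => ?_, fun i _ => ?_⟩, Finset.ext hmem⟩
    · have := h i
      simp only [hi, Nat.count_zero] at this
      split_ifs at this <;> omega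
    · have hsup : (Finset.univ.filter fun j => j < i).sup w =
          Nat.count (· ∈ L.map Fin.valEmbedding) i := by
        have : (Finset.univ.filter fun j => j < i).sup w =
            ((Finset.univ.filter fun j : Fin n => (j : ℕ) < i).image w).sup id := by
          rw [Finset.sup_image]
          rfl
        rw [this, himg i i.isLt.le]
        refine le_antisymm (Finset.sup_le fun t ht => (Finset.mem_Icc.1 ht).2) ?_
        rcases Nat.eq_zero_or_pos (Nat.count (· ∈ L.map Fin.valEmbedding) i) with h0 | h0
        · rw [h0]
          exact Nat.zero_le _
        · exact Finset.le_sup (f := id) (Finset.mem_Icc.2 ⟨h0, le_rfl⟩)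
      rw [hsup]
      refine (h i).1.2.trans ?_
      split_ifs <;> omega

lemma rsi_eq_card (w : Fin n → ℕ) (i : Fin n) :
    rsi w i = (((Finset.Ioi i).image w).filter (· < w i)).card := by
  rw [rsi, ← Finset.card_image_of_injOn (f := w)]
  · congr 1
    ext t
    simp only [Rset, Finset.mem_image, Finset.mem_filter, Finset.mem_univ, true_and, Finset.mem_Ioi]
    constructor
    · rintro ⟨j, ⟨-, h1, h2⟩, rfl⟩
      exact ⟨⟨j, h1, rfl⟩, h2⟩
    · rintro ⟨⟨j, h1, rfl⟩, h2⟩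
      obtain ⟨j', hj', hmax⟩ := (Finset.univ.filter fun j' => w j' = w j).exists_max_image id
        ⟨j, by simp⟩
      simp only [Finset.mem_filter, Finset.mem_univ, true_and, id] at hj' hmax
      refine ⟨j', ⟨fun l hl h => ?_, h1.trans_le (hmax j rfl), hj' ▸ h2⟩, hj'⟩
      exact absurd (hmax l (h.trans hj')) (not_le.2 hl)
  · intro j hj l hl h
    simp only [Rset, Finset.coe_filter, Finset.mem_filter, Finset.mem_univ, true_and,
      Set.mem_ofPred_eq] at hj hl
    rcases lt_trichotomy j l with hlt | rfl | hlt
    · exact absurd h.symm (hj.1 l hlt)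
    · rfl
    · exact absurd h (hl.1 j hlt)

lemma rsi_eq_countBelow {w : Fin n → ℕ} (hw : IsRGF w) (i : Fin n) :
    rsi w i = countBelow (∅ ∪ (Finset.Ioi i).image fun j => w j - 0) (w i) := by
  rw [rsi_eq_card, countBelow]
  congr 1
  ext t
  simp only [Finset.mem_filter, Finset.mem_image, Finset.mem_inter, Finset.mem_Ico,
    Finset.empty_union, Nat.sub_zero]
  constructor
  · rintro ⟨⟨j, hj, rfl⟩, h⟩
    exact ⟨⟨j, hj, rfl⟩, hw.1 j, h⟩
  · rintro ⟨h1, -, h2⟩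
    exact ⟨h1, h2⟩

lemma vrsi_eq_countBelow {w : Fin n → ℕ} (hw : IsRGF w) (i : Fin n) :
    vrsi w i = countBelow (∅ ∪ (Finset.Ioi i).image fun j => w j - 1) (w i) := by
  have hpos : ∀ t ∈ (Finset.Ioi i).image w, 1 ≤ t := by
    intro t ht
    obtain ⟨j, -, rfl⟩ := Finset.mem_image.1 ht
    exact hw.1 j
  have hR : i ∉ Rset w ↔ w i ∈ (Finset.Ioi i).image w := by
    simp [Rset]
  have hpro : (i : ℕ) + 1 < pro w ↔ 1 ∈ (Finset.Ioi i).image w := by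
    simp only [pro, Finset.lt_sup_iff, Finset.mem_filter, Finset.mem_univ, true_and,
      Finset.mem_image, Finset.mem_Ioi, Fin.lt_def]
    exact exists_congr fun j => by omega
  have hpro' : pro w = i + 1 → w i = 1 := by
    intro h
    have hne : (Finset.univ.filter fun j => w j = 1).Nonempty := by
      by_contra hc
      rw [pro, Finset.not_nonempty_iff_eq_empty.1 hc] at h
      simp at h
    obtain ⟨j, hj, hj'⟩ := Finset.exists_mem_eq_sup _ hne fun j : Fin n => (j : ℕ) + 1
    rw [pro, hj'] at h
    obtain rfl : j = i := Fin.ext (by omega)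
    exact (Finset.mem_filter.1 hj).2
  have hv : countBelow (∅ ∪ (Finset.Ioi i).image fun j => w j - 1) (w i) =
      (((Finset.Ioi i).image w).filter fun t => 1 < t ∧ t ≤ w i).card := by
    have hwi := hw.1 i
    rw [countBelow, Finset.empty_union]
    refine Finset.card_bij' (fun t _ => t + 1) (fun t _ => t - 1) ?_ ?_ ?_ ?_
    · intro t ht
      simp only [Finset.mem_inter, Finset.mem_image, Finset.mem_Ico, Finset.mem_filter] at ht ⊢
      obtain ⟨⟨j, hj, rfl⟩, h⟩ := ht
      exact ⟨⟨j, hj, by omega⟩, by omega⟩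
    · intro t ht
      simp only [Finset.mem_inter, Finset.mem_image, Finset.mem_Ico, Finset.mem_filter] at ht ⊢
      obtain ⟨⟨j, hj, rfl⟩, h⟩ := ht
      exact ⟨⟨j, hj, rfl⟩, by omega⟩
    · intro t _
      simp
    · intro t ht
      have := (Finset.mem_filter.1 ht).2.1
      omega
  have hwi := hw.1 i
  rw [hv, vrsi, rsi_eq_card]
  simp only [hR, hpro]
  generalize (Finset.Ioi i).image w = S at *
  have e1 : (S.filter fun t => t ≤ w i).card =
      (S.filter (· < w i)).card + if w i ∈ S then 1 else 0 := by
    rw [← Finset.card_filter_add_card_filter_not (s := S.filter fun t => t ≤ w i) (· < w i),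
      Finset.filter_filter, Finset.filter_filter]
    congr 1
    · congr 1
      exact Finset.filter_congr fun t _ => by omega
    · rw [Finset.filter_congr (q := fun t => t = w i) fun t _ => by omega, Finset.filter_eq']
      split_ifs <;> simp
  have e2 : (S.filter fun t => t ≤ w i).card =
      (S.filter fun t => 1 < t ∧ t ≤ w i).card + if 1 ∈ S then 1 else 0 := by
    rw [← Finset.card_filter_add_card_filter_not (s := S.filter fun t => t ≤ w i) (1 < ·),
      Finset.filter_filter, Finset.filter_filter]
    congr 1
    · congr 1
      exact Finset.filter_congr fun t _ => by omega
    · rw [Finset.filter_congr (q := fun t => t = 1) fun t ht => by have := hpos t ht; omega,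
        Finset.filter_eq']
      split_ifs <;> simp
  rw [e1] at e2
  by_cases h1 : w i ∈ S <;> by_cases h2 : 1 ∈ S <;> simp only [h1, h2, if_true, if_false] at e2 ⊢ <;>
    grind

lemma AscSet_eq_iff (w : Fin n → ℕ) (A : Finset (Fin n)) :
    AscSet w = A ↔ ∀ i : Fin n, (i : ℕ) ∈ A.map Fin.valEmbedding ↔
      w i < if h : (i : ℕ) + 1 < n then w ⟨i + 1, h⟩ else 0 := by
  rw [eq_comm, Finset.ext_iff]
  refine forall_congr' fun i => iff_congr (by simp [Fin.val_inj]) ?_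
  simp only [AscSet, Finset.mem_filter, Finset.mem_univ, true_and]
  constructor
  · rintro ⟨j, hj, h⟩
    have hj' : (i : ℕ) + 1 < n := hj ▸ j.isLt
    rw [dif_pos hj', show (⟨i + 1, hj'⟩ : Fin n) = j from Fin.ext hj.symm]
    exact h
  · intro h
    split_ifs at h with hj
    · exact ⟨_, rfl, h⟩
    · simp at h

lemma mem_words_iff {s : ℕ} {stat : (Fin n → ℕ) → Fin n → ℕ}
    (hstat : ∀ w : Fin n → ℕ, IsRGF w → ∀ i,
      stat w i = countBelow (∅ ∪ (Finset.Ioi i).image fun j => w j - s) (w i))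
    (L A : Finset (Fin n)) (v : Fin n → ℕ) (w : Fin n → ℕ) :
    w ∈ words s (L.map Fin.valEmbedding) (A.map Fin.valEmbedding)
        (fun i => if h : i < n then v ⟨i, h⟩ else 0) n ∅ 0 ↔
      IsRGF w ∧ (Lset w, AscSet w, stat w) = (L, A, v) := by
  rw [mem_words, Prod.mk.injEq, Prod.mk.injEq, ← and_assoc, isRGF_and_Lset_eq_iff, AscSet_eq_iff]
  constructor
  · intro h
    have h1 := fun i => And.intro (h i).1 (h i).2.1
    refine ⟨h1, fun i => (h i).2.2.2, funext fun i => ?_⟩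
    rw [hstat w ((isRGF_and_Lset_eq_iff w L).2 h1).1, (h i).2.2.1]
    simp
  · rintro ⟨h1, h2, rfl⟩ i
    refine ⟨(h1 i).1, (h1 i).2, ?_, h2 i⟩
    rw [← hstat w ((isRGF_and_Lset_eq_iff w L).2 h1).1]
    simp

/-- The fibre of `(Lset, AscSet, stat)` over a triple is a finset of words. -/
def fiberEquivWords {s : ℕ} {stat : (Fin n → ℕ) → Fin n → ℕ}
    (hstat : ∀ w : Fin n → ℕ, IsRGF w → ∀ i,
      stat w i = countBelow (∅ ∪ (Finset.Ioi i).image fun j => w j - s) (w i))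
    (c : Finset (Fin n) × Finset (Fin n) × (Fin n → ℕ)) :
    {w : {w : Fin n → ℕ // IsRGF w} // (Lset (w : Fin n → ℕ), AscSet (w : Fin n → ℕ), stat w) = c} ≃
      words s (c.1.map Fin.valEmbedding) (c.2.1.map Fin.valEmbedding)
        (fun i => if h : i < n then c.2.2 ⟨i, h⟩ else 0) n ∅ 0 :=
  (Equiv.subtypeSubtypeEquivSubtypeInter IsRGF
    fun w => (Lset w, AscSet w, stat w) = c).trans
    (Equiv.subtypeEquivRight fun w => (mem_words_iff hstat c.1 c.2.1 c.2.2 w).symm)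

/-- There is a bijection ζ on RG(n) preserving L and Asc with rsᵢ(ζ(w)) = vrsᵢ(w). -/
theorem stmt11 (n : ℕ) (hn : 1 ≤ n) :
    ∃ ζ : {w : Fin n → ℕ // IsRGF w} ≃ {w : Fin n → ℕ // IsRGF w},
      ∀ w : {w : Fin n → ℕ // IsRGF w},
        Lset ((ζ w) : Fin n → ℕ) = Lset (w : Fin n → ℕ) ∧
        AscSet ((ζ w) : Fin n → ℕ) = AscSet (w : Fin n → ℕ) ∧
        ∀ i : Fin n, rsi ((ζ w) : Fin n → ℕ) i = vrsi (w : Fin n → ℕ) i := by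
  let e := fun c : Finset (Fin n) × Finset (Fin n) × (Fin n → ℕ) =>
    (fiberEquivWords (fun w hw => vrsi_eq_countBelow hw) c).trans
      ((Finset.equivOfCardEq (card_words_shift_eq _ _ _ _ _).symm).trans
        (fiberEquivWords (fun w hw => rsi_eq_countBelow hw) c).symm)
  refine ⟨Equiv.ofFiberEquiv e, fun w => ?_⟩
  have h := Equiv.ofFiberEquiv_map e w
  rw [Prod.mk.injEq, Prod.mk.injEq] at h
  exact ⟨h.1, h.2.1, congrFun h.2.2⟩
end

section
/- There exists an involution ψ on S_n such that for every π ∈ S_n: F(ψ(π)) = F(π), E(ψ(π)) = E(π), des(ψ(π)) = des(π), Id(ψ(π)) = Id(π), STAT(ψ(π)) = BAST(π), and BAST(ψ(π)) = STAT(π). In particular, (F, E, des, Id, STAT, BAST) and (F, E, des, Id, BAST, STAT) are equidistributed on S_n. -/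
open Finset

variable {n : ℕ}

/-- The word (in one-line notation, with letters `1,...,n`) of a permutation of `[n]`. -/
def pw (p : Equiv.Perm (Fin n)) : Fin n → ℕ := fun i => (p i : ℕ) + 1

/-- Descent number of a word: positions `i` with `w_i > w_{i+1}`. -/
def desW (w : Fin n → ℕ) : ℕ :=
  (Finset.univ.filter fun i : Fin n => ∃ j : Fin n, (j : ℕ) = (i : ℕ) + 1 ∧ w j < w i).card

/-- Major index of a word: the sum of the (1-indexed) descent positions. -/
def majW (w : Fin n → ℕ) : ℕ :=
  ∑ i ∈ Finset.univ.filter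
      (fun i : Fin n => ∃ j : Fin n, (j : ℕ) = (i : ℕ) + 1 ∧ w j < w i), ((i : ℕ) + 1)

/-- Occurrences of the vincular pattern 2-31: `i < j` with `w_{j+1} < w_i < w_j`. -/
def pat2_31 (w : Fin n → ℕ) : ℕ :=
  ((Finset.univ ×ˢ Finset.univ).filter fun q : Fin n × Fin n =>
    q.1 < q.2 ∧ ∃ j' : Fin n, (j' : ℕ) = (q.2 : ℕ) + 1 ∧ w j' < w q.1 ∧ w q.1 < w q.2).card

/-- Occurrences of the vincular pattern 2-13: `i < j` with `w_j < w_i < w_{j+1}`. -/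
def pat2_13 (w : Fin n → ℕ) : ℕ :=
  ((Finset.univ ×ˢ Finset.univ).filter fun q : Fin n × Fin n =>
    q.1 < q.2 ∧ ∃ j' : Fin n, (j' : ℕ) = (q.2 : ℕ) + 1 ∧ w q.2 < w q.1 ∧ w q.1 < w j').card

/-- Occurrences of the vincular pattern 1-32: `i < j` with `w_i < w_{j+1} < w_j`. -/
def pat1_32 (w : Fin n → ℕ) : ℕ :=
  ((Finset.univ ×ˢ Finset.univ).filter fun q : Fin n × Fin n =>
    q.1 < q.2 ∧ ∃ j' : Fin n, (j' : ℕ) = (q.2 : ℕ) + 1 ∧ w q.1 < w j' ∧ w j' < w q.2).card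

/-- Occurrences of the vincular pattern 3-21: `i < j` with `w_{j+1} < w_j < w_i`. -/
def pat3_21 (w : Fin n → ℕ) : ℕ :=
  ((Finset.univ ×ˢ Finset.univ).filter fun q : Fin n × Fin n =>
    q.1 < q.2 ∧ ∃ j' : Fin n, (j' : ℕ) = (q.2 : ℕ) + 1 ∧ w j' < w q.2 ∧ w q.2 < w q.1).card

/-- The Babson–Steingrímsson statistic BAST = (21) + (2-13) + (1-32) + (3-21). -/
def BAST (w : Fin n → ℕ) : ℕ := desW w + pat2_13 w + pat1_32 w + pat3_21 w

/-- `w` avoids the vincular pattern 1-32: there is no `i < j` with `w_i < w_{j+1} < w_j`. -/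
def Avoids132 (w : Fin n → ℕ) : Prop :=
  ∀ i j j' : Fin n, i < j → (j' : ℕ) = (j : ℕ) + 1 → ¬(w i < w j' ∧ w j' < w j)

/-- Occurrences of the vincular pattern 13-2: `i+1 < j` with `w_i < w_j < w_{i+1}`. -/
def pat13_2 (w : Fin n → ℕ) : ℕ :=
  ((Finset.univ ×ˢ Finset.univ).filter fun q : Fin n × Fin n =>
    ∃ i' : Fin n, (i' : ℕ) = (q.1 : ℕ) + 1 ∧ i' < q.2 ∧ w q.1 < w q.2 ∧ w q.2 < w i').card

/-- Occurrences of the vincular pattern 21-3: `i+1 < j` with `w_{i+1} < w_i < w_j`. -/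
def pat21_3 (w : Fin n → ℕ) : ℕ :=
  ((Finset.univ ×ˢ Finset.univ).filter fun q : Fin n × Fin n =>
    ∃ i' : Fin n, (i' : ℕ) = (q.1 : ℕ) + 1 ∧ i' < q.2 ∧ w i' < w q.1 ∧ w q.1 < w q.2).card

/-- Occurrences of the vincular pattern 32-1: `i+1 < j` with `w_j < w_{i+1} < w_i`. -/
def pat32_1 (w : Fin n → ℕ) : ℕ :=
  ((Finset.univ ×ˢ Finset.univ).filter fun q : Fin n × Fin n =>
    ∃ i' : Fin n, (i' : ℕ) = (q.1 : ℕ) + 1 ∧ i' < q.2 ∧ w q.2 < w i' ∧ w i' < w q.1).card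

/-- The Babson–Steingrímsson statistic STAT = (21) + (13-2) + (21-3) + (32-1). -/
def STAT (w : Fin n → ℕ) : ℕ := desW w + pat13_2 w + pat21_3 w + pat32_1 w

/-- The descent set of a word. -/
def DesSet (w : Fin n → ℕ) : Finset (Fin n) :=
  Finset.univ.filter fun i : Fin n => ∃ j : Fin n, (j : ℕ) = (i : ℕ) + 1 ∧ w j < w i

/-- Id(p) = Des(p⁻¹), the descent set of the inverse permutation. -/
def IdSet (p : Equiv.Perm (Fin n)) : Finset (Fin n) := DesSet (pw p⁻¹)

/-- The word of `π` with letters `0, ..., n - 1`, extended by `0` to all positions. -/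
def extWord (π : Equiv.Perm (Fin n)) (i : ℕ) : ℕ := if h : i < n then π ⟨i, h⟩ else 0

/-- The number of descents of `π` at (zero-based) positions below `i`. -/
def desBelow (π : Equiv.Perm (Fin n)) (i : ℕ) : ℕ :=
  ∑ j ∈ range i, if extWord π (j + 1) < extWord π j then 1 else 0

/-- The comajor index of `π`: every descent counts the letters to its right. -/
def comaj (π : Equiv.Perm (Fin n)) : ℕ := ∑ i : Fin n, desBelow π i

@[simp] lemma extWord_val (π : Equiv.Perm (Fin n)) (i : Fin n) : extWord π i = π i := by
  simp [extWord]

lemma extWord_of_lt (π : Equiv.Perm (Fin n)) {i : ℕ} (h : i < n) : extWord π i = π ⟨i, h⟩ := by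
  simp [extWord, h]

lemma extWord_ne (π : Equiv.Perm (Fin n)) {i j : ℕ} (hi : i < n) (hj : j < n) (hij : i ≠ j) :
    extWord π i ≠ extWord π j := by
  rw [extWord_of_lt π hi, extWord_of_lt π hj]
  intro h
  exact hij (by simpa using π.injective (Fin.ext h))

@[simp] lemma desBelow_zero (π : Equiv.Perm (Fin n)) : desBelow π 0 = 0 := by simp [desBelow]

lemma desBelow_succ (π : Equiv.Perm (Fin n)) (i : ℕ) :
    desBelow π (i + 1) =
      desBelow π i + if extWord π (i + 1) < extWord π i then 1 else 0 := by
  rw [desBelow, sum_range_succ, desBelow]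

lemma sum_ite_fin_eq_sum_range {P : Fin n → Prop} [DecidablePred P] {Q : ℕ → Prop}
    [DecidablePred Q] (h : ∀ i : Fin n, P i ↔ Q i) :
    (∑ i : Fin n, if P i then 1 else 0) = ∑ i ∈ range n, if Q i then 1 else 0 := by
  rw [← Fin.sum_univ_eq_sum_range (fun i => if Q i then 1 else 0)]
  simp [h]

lemma exists_succ_iff (P : ℕ → Prop) (i : ℕ) :
    (∃ j : Fin n, (j : ℕ) = i + 1 ∧ P j) ↔ i + 1 < n ∧ P (i + 1) := by
  constructor
  · rintro ⟨j, hj, h⟩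
    exact ⟨hj ▸ j.2, hj ▸ h⟩
  · rintro ⟨h, h'⟩
    exact ⟨⟨i + 1, h⟩, rfl, h'⟩

lemma sum_range_ite_eq_sum_Ico {p q : ℕ} (hq : q ≤ n) (Q : ℕ → Prop) [DecidablePred Q] :
    (∑ i ∈ range n, if (p ≤ i ∧ i < q) ∧ Q i then 1 else 0) =
      ∑ i ∈ Ico p q, if Q i then 1 else 0 := by
  have : Ico p q = (range n).filter fun i => p ≤ i ∧ i < q := by
    ext i; simp; omega
  rw [this, sum_filter]
  simp only [ite_and]

lemma pw_eq (π : Equiv.Perm (Fin n)) (i : Fin n) : pw π i = extWord π i + 1 := by simp [pw]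

/-- Going from position `p` to position `q`, the crossings of a level `c` telescope. -/
lemma sum_Ico_crossings (V : ℕ → ℕ) (c p q : ℕ) (hpq : p ≤ q)
    (hc : ∀ i, p ≤ i → i ≤ q → V i ≠ c) :
    (∑ i ∈ Ico p q, if V i < c ∧ c < V (i + 1) then 1 else 0) +
      (∑ i ∈ Ico p q, if V (i + 1) < V i ∧ V i < c then 1 else 0) +
      (∑ i ∈ Ico p q, if c < V (i + 1) ∧ V (i + 1) < V i then 1 else 0) +
      (if c < V p then 1 else 0) =
    (∑ i ∈ Ico p q, if V (i + 1) < V i then 1 else 0) + if c < V q then 1 else 0 := by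
  induction q, hpq using Nat.le_induction with
  | base => simp
  | succ q hpq ih =>
    have ih := ih fun i h h' => hc i h (by omega)
    have h1 := hc q hpq (by omega)
    have h2 := hc (q + 1) (by omega) le_rfl
    simp only [sum_Ico_succ_top hpq]
    grind

lemma desW_pw (m : ℕ) (π : Equiv.Perm (Fin (m + 1))) : desW (pw π) = desBelow π m := by
  rw [desW, card_filter, desBelow, ← Nat.Ico_zero_eq_range,
    ← sum_range_ite_eq_sum_Ico (n := m + 1) (by omega)]
  refine sum_ite_fin_eq_sum_range fun i => ?_
  simp only [pw_eq, exists_succ_iff fun j => extWord π j + 1 < extWord π i + 1]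
  omega

lemma pat13_2_pw (π : Equiv.Perm (Fin n)) :
    pat13_2 (pw π) = ∑ j : Fin n, ∑ i ∈ Ico 0 ((j : ℕ) - 1),
      if extWord π i < extWord π j ∧ extWord π j < extWord π (i + 1) then 1 else 0 := by
  rw [pat13_2, card_filter, sum_product_right]
  refine sum_congr rfl fun j _ => ?_
  rw [← sum_range_ite_eq_sum_Ico (n := n) (by omega)]
  refine sum_ite_fin_eq_sum_range fun i => ?_
  simp only [pw_eq, Fin.lt_def, exists_succ_iff fun k => k < (j : ℕ) ∧
    extWord π i + 1 < extWord π j + 1 ∧ extWord π j + 1 < extWord π k + 1]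
  omega

lemma pat21_3_pw (π : Equiv.Perm (Fin n)) :
    pat21_3 (pw π) = ∑ j : Fin n, ∑ i ∈ Ico 0 ((j : ℕ) - 1),
      if extWord π (i + 1) < extWord π i ∧ extWord π i < extWord π j then 1 else 0 := by
  rw [pat21_3, card_filter, sum_product_right]
  refine sum_congr rfl fun j _ => ?_
  rw [← sum_range_ite_eq_sum_Ico (n := n) (by omega)]
  refine sum_ite_fin_eq_sum_range fun i => ?_
  simp only [pw_eq, Fin.lt_def, exists_succ_iff fun k => k < (j : ℕ) ∧
    extWord π k + 1 < extWord π i + 1 ∧ extWord π i + 1 < extWord π j + 1]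
  omega

lemma pat32_1_pw (π : Equiv.Perm (Fin n)) :
    pat32_1 (pw π) = ∑ j : Fin n, ∑ i ∈ Ico 0 ((j : ℕ) - 1),
      if extWord π j < extWord π (i + 1) ∧ extWord π (i + 1) < extWord π i then 1 else 0 := by
  rw [pat32_1, card_filter, sum_product_right]
  refine sum_congr rfl fun j _ => ?_
  rw [← sum_range_ite_eq_sum_Ico (n := n) (by omega)]
  refine sum_ite_fin_eq_sum_range fun i => ?_
  simp only [pw_eq, Fin.lt_def, exists_succ_iff fun k => k < (j : ℕ) ∧
    extWord π j + 1 < extWord π k + 1 ∧ extWord π k + 1 < extWord π i + 1]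
  omega

lemma pat2_13_pw (m : ℕ) (π : Equiv.Perm (Fin (m + 1))) :
    pat2_13 (pw π) = ∑ i : Fin (m + 1), ∑ j ∈ Ico ((i : ℕ) + 1) m,
      if extWord π j < extWord π i ∧ extWord π i < extWord π (j + 1) then 1 else 0 := by
  rw [pat2_13, card_filter, sum_product]
  refine sum_congr rfl fun i _ => ?_
  rw [← sum_range_ite_eq_sum_Ico (n := m + 1) (by omega)]
  refine sum_ite_fin_eq_sum_range fun j => ?_
  simp only [pw_eq, Fin.lt_def, exists_succ_iff fun k =>
    extWord π j + 1 < extWord π i + 1 ∧ extWord π i + 1 < extWord π k + 1]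
  omega

lemma pat1_32_pw (m : ℕ) (π : Equiv.Perm (Fin (m + 1))) :
    pat1_32 (pw π) = ∑ i : Fin (m + 1), ∑ j ∈ Ico ((i : ℕ) + 1) m,
      if extWord π i < extWord π (j + 1) ∧ extWord π (j + 1) < extWord π j then 1 else 0 := by
  rw [pat1_32, card_filter, sum_product]
  refine sum_congr rfl fun i _ => ?_
  rw [← sum_range_ite_eq_sum_Ico (n := m + 1) (by omega)]
  refine sum_ite_fin_eq_sum_range fun j => ?_
  simp only [pw_eq, Fin.lt_def, exists_succ_iff fun k =>
    extWord π i + 1 < extWord π k + 1 ∧ extWord π k + 1 < extWord π j + 1]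
  omega

lemma pat3_21_pw (m : ℕ) (π : Equiv.Perm (Fin (m + 1))) :
    pat3_21 (pw π) = ∑ i : Fin (m + 1), ∑ j ∈ Ico ((i : ℕ) + 1) m,
      if extWord π (j + 1) < extWord π j ∧ extWord π j < extWord π i then 1 else 0 := by
  rw [pat3_21, card_filter, sum_product]
  refine sum_congr rfl fun i _ => ?_
  rw [← sum_range_ite_eq_sum_Ico (n := m + 1) (by omega)]
  refine sum_ite_fin_eq_sum_range fun j => ?_
  simp only [pw_eq, Fin.lt_def, exists_succ_iff fun k =>
    extWord π k + 1 < extWord π j + 1 ∧ extWord π j + 1 < extWord π i + 1]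
  omega

lemma sum_ite_apply_lt (π : Equiv.Perm (Fin n)) (a : Fin n) :
    (∑ j : Fin n, if π j < a then 1 else 0) = (a : ℕ) := by
  rw [Equiv.sum_comp π (fun x => if x < a then 1 else 0), ← card_filter,
    filter_gt_eq_Iio, Fin.card_Iio]

lemma STAT_pw (m : ℕ) (π : Equiv.Perm (Fin (m + 1))) :
    STAT (pw π) + π 0 = desBelow π m + comaj π := by
  rw [STAT, desW_pw, pat13_2_pw, pat21_3_pw, pat32_1_pw, ← sum_ite_apply_lt π (π 0), comaj,
    add_assoc, add_assoc, add_assoc, ← sum_add_distrib, ← sum_add_distrib, ← sum_add_distrib]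
  congr 1
  refine sum_congr rfl fun j _ => ?_
  obtain ⟨j, hj⟩ := j
  rcases j with _ | j
  · simp [desBelow]
  · have h := sum_Ico_crossings (extWord π) (extWord π (j + 1)) 0 j (by omega)
      fun i _ hi => extWord_ne π (by omega) hj (by omega)
    have h0 : extWord π 0 = π 0 := extWord_val π 0
    rw [desBelow_succ, desBelow, ← Nat.Ico_zero_eq_range, ← h, h0, extWord_of_lt π hj]
    simp only [Fin.lt_def, Nat.add_sub_cancel]
    ring

lemma BAST_pw (m : ℕ) (π : Equiv.Perm (Fin (m + 1))) :
    BAST (pw π) + comaj π + m = (m + 2) * desBelow π m + π (Fin.last m) := by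
  have key : ∀ i : Fin (m + 1),
      ((∑ j ∈ Ico ((i : ℕ) + 1) m,
        if extWord π j < extWord π i ∧ extWord π i < extWord π (j + 1) then 1 else 0) +
      (∑ j ∈ Ico ((i : ℕ) + 1) m,
        if extWord π i < extWord π (j + 1) ∧ extWord π (j + 1) < extWord π j then 1 else 0) +
      (∑ j ∈ Ico ((i : ℕ) + 1) m,
        if extWord π (j + 1) < extWord π j ∧ extWord π j < extWord π i then 1 else 0)) +
      desBelow π i + (if i < Fin.last m then 1 else 0) =
      desBelow π m + if π i < π (Fin.last m) then 1 else 0 := by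
    intro i
    obtain ⟨i, hi⟩ := i
    rcases Nat.lt_or_ge i m with him | him
    · have h := sum_Ico_crossings (extWord π) (extWord π i) (i + 1) m (by omega)
        fun k hk hk' => extWord_ne π (by omega) hi (by omega)
      have hd : desBelow π m = desBelow π (i + 1) +
          ∑ j ∈ Ico (i + 1) m, if extWord π (j + 1) < extWord π j then 1 else 0 := by
        simp only [desBelow, sum_range_add_sum_Ico _ (show i + 1 ≤ m by omega)]
      have hl : extWord π m = π (Fin.last m) := extWord_val π (Fin.last m)
      have hne := extWord_ne π hi (show i + 1 < m + 1 by omega) (by omega)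
      rw [hl] at h
      rw [desBelow_succ] at hd
      simp only [Fin.lt_def, Fin.val_last, him, if_true, ← extWord_of_lt π hi]
      split_ifs at h hd ⊢ <;> omega
    · obtain rfl : i = m := by omega
      simp [Fin.last]
  have hs := sum_congr (rfl : (univ : Finset (Fin (m + 1))) = univ) fun i _ => key i
  simp only [sum_add_distrib] at hs
  rw [sum_ite_apply_lt π, ← pat2_13_pw, ← pat1_32_pw, ← pat3_21_pw] at hs
  have h1 : (∑ i : Fin (m + 1), if i < Fin.last m then 1 else 0) = m := by
    rw [← card_filter, filter_gt_eq_Iio, Fin.card_Iio, Fin.val_last]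
  rw [h1] at hs
  simp only [sum_const, card_univ, Fintype.card_fin, smul_eq_mul] at hs
  rw [BAST, desW_pw, comaj]
  linarith

/-- Every class of a monotone colouring of `Fin n` is an interval, and can be reversed in place. -/
lemma exists_involutive_reversing {β : Fin n → ℕ} (hβ : Monotone β) :
    ∃ r : Fin n → Fin n, Function.Involutive r ∧ (∀ x, β (r x) = β x) ∧
      ∀ x y, β x = β y → x ≤ y → r y ≤ r x := by
  have hne (x : Fin n) : (univ.filter fun y => β y = β x).Nonempty := ⟨x, by simp⟩
  set lo : Fin n → Fin n := fun x => (univ.filter fun y => β y = β x).min' (hne x) with hlo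
  set hi : Fin n → Fin n := fun x => (univ.filter fun y => β y = β x).max' (hne x) with hhi
  have lo_le (x) : lo x ≤ x := min'_le _ _ (by simp)
  have le_hi (x) : x ≤ hi x := le_max' _ _ (by simp)
  have β_lo (x) : β (lo x) = β x := (mem_filter.1 (min'_mem _ (hne x))).2
  have β_hi (x) : β (hi x) = β x := (mem_filter.1 (max'_mem _ (hne x))).2
  have lo_congr {x y} (h : β x = β y) : lo x = lo y := by simp only [hlo, h]
  have hi_congr {x y} (h : β x = β y) : hi x = hi y := by simp only [hhi, h]
  have hr (x : Fin n) : (lo x : ℕ) + hi x - x < n := by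
    have := lo_le x; have := (hi x).2; rw [Fin.le_def] at *; omega
  set r : Fin n → Fin n := fun x => ⟨lo x + hi x - x, hr x⟩ with hrdef
  have β_r (x) : β (r x) = β x := by
    have h1 := lo_le x
    have h2 := le_hi x
    refine le_antisymm ((hβ (?_ : r x ≤ hi x)).trans (β_hi x).le)
      ((β_lo x).ge.trans (hβ (?_ : lo x ≤ r x))) <;>
    · rw [Fin.le_def] at *
      simp only [hrdef]
      omega
  refine ⟨r, fun x => ?_, β_r, fun x y hxy hle => ?_⟩
  · have h1 := lo_le x
    have h2 := le_hi x
    have h3 := lo_congr (β_r x)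
    have h4 := hi_congr (β_r x)
    ext
    change (lo (r x) : ℕ) + hi (r x) - (lo x + hi x - x) = x
    rw [h3, h4]
    rw [Fin.le_def] at *
    omega
  · have h3 := lo_congr hxy
    have h4 := hi_congr hxy
    rw [Fin.le_def] at *
    simp only [hrdef, h3, h4]
    omega

lemma exists_involutive_reversing_off {τ : Fin n → ℕ} (hτ : Monotone τ) (a b : Fin n) :
    ∃ r : Fin n → Fin n, Function.Involutive r ∧
      (∀ x, τ (r x) = τ x ∧ (r x < a ↔ x < a) ∧ (r x = a ↔ x = a) ∧
        (b < r x ↔ b < x) ∧ (r x = b ↔ x = b)) ∧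
      ∀ x y, x ≤ y → τ x = τ y → ¬(x ≤ a ∧ a ≤ y) → ¬(x ≤ b ∧ b ≤ y) → r y ≤ r x := by
  set β : Fin n → ℕ := fun x => τ x + (if a ≤ x then 1 else 0) + (if a < x then 1 else 0) +
    (if b ≤ x then 1 else 0) + (if b < x then 1 else 0) with hβdef
  have mono (x y : Fin n) (hxy : x ≤ y) : β x ≤ β y ∧ (β x = β y → τ x = τ y ∧
      (x < a ↔ y < a) ∧ (x = a ↔ y = a) ∧ (b < x ↔ b < y) ∧ (x = b ↔ y = b)) := by
    have := hτ hxy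
    simp only [hβdef, Fin.le_def, Fin.lt_def, Fin.ext_iff] at *
    refine ⟨by split_ifs <;> omega, fun h => ?_⟩
    split_ifs at h <;> omega
  obtain ⟨r, hr, hβr, hrev⟩ := exists_involutive_reversing fun x y hxy => (mono x y hxy).1
  refine ⟨r, hr, fun x => ?_, fun x y hxy hτxy ha hb => hrev x y ?_ hxy⟩
  · rcases le_total x (r x) with h | h
    · have := (mono _ _ h).2 (hβr x).symm
      tauto
    · exact (mono _ _ h).2 (hβr x)
  · simp only [hβdef, Fin.le_def, Fin.lt_def] at *
    grind

/-- Labelings of the letters by `0, ..., s`, weakly increasing on the classes of `τ`, for which the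
sorted list of letters starts with `a`, labelled `0`, and ends with `b`, labelled `s`. -/
def labelings (τ : Fin n → ℕ) (a b : Fin n) (s : ℕ) : Finset (Fin n → ℕ) :=
  (Fintype.piFinset fun _ => range (s + 1)).filter fun h =>
    h a = 0 ∧ h b = s ∧ (∀ x, x < a → 0 < h x) ∧ (∀ x, b < x → h x < s) ∧
      ∀ x y, x ≤ y → τ x = τ y → h x ≤ h y

lemma mem_labelings {τ : Fin n → ℕ} {a b : Fin n} {s : ℕ} {h : Fin n → ℕ} :
    h ∈ labelings τ a b s ↔ (∀ x, h x ≤ s) ∧ h a = 0 ∧ h b = s ∧ (∀ x, x < a → 0 < h x) ∧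
      (∀ x, b < x → h x < s) ∧ ∀ x y, x ≤ y → τ x = τ y → h x ≤ h y := by
  simp [labelings]

/-- Complementing a labeling class by class, away from the letters `a` and `b`. -/
lemma sum_labelings_reflect {τ : Fin n → ℕ} (hτ : Monotone τ) {a b : Fin n} (hab : a ≠ b) (s : ℕ)
    (f : ℤ → ℤ) :
    ∑ h ∈ labelings τ a b s, f (∑ x, (h x : ℤ)) =
      ∑ h ∈ labelings τ a b s, f (n * s + a + b + 1 - n - ∑ x, (h x : ℤ)) := by
  obtain ⟨r, hr, hrx, hrev⟩ := exists_involutive_reversing_off hτ a b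
  set C : (Fin n → ℕ) → Fin n → ℕ := fun h x => if x = a ∨ x = b then h x else
    ((if x < a then 1 else 0) + s - if b < x then 1 else 0) - h (r x) with hC
  have bounds {h} (hh : h ∈ labelings τ a b s) (x) (hx : ¬(x = a ∨ x = b)) :
      (if x < a then 1 else 0) ≤ h (r x) ∧ h (r x) + (if b < x then 1 else 0) ≤ s := by
    rw [mem_labelings] at hh
    obtain ⟨h0, -, -, h1, h2, -⟩ := hh
    obtain ⟨-, h3, -, h4, -⟩ := hrx x
    have h0 := h0 (r x)
    have h1 := h1 (r x)
    have h2 := h2 (r x)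
    rw [h3] at h1
    rw [h4] at h2
    grind
  have C_mem {h} (hh : h ∈ labelings τ a b s) : C h ∈ labelings τ a b s := by
    have hb := fun x hx => bounds hh x hx
    rw [mem_labelings] at hh ⊢
    obtain ⟨h0, ha, hb', h1, h2, h3⟩ := hh
    have C_le (x) : C h x ≤ s := by
      simp only [hC]
      split_ifs with hx
      · exact h0 x
      all_goals have := hb x hx; simp_all; try omega
    refine ⟨C_le, by simp [hC, ha], by simp [hC, hb'], fun x hx => ?_, fun x hx => ?_,
      fun x y hxy hτxy => ?_⟩
    · by_cases hxab : x = a ∨ x = b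
      · simpa [hC, hxab] using h1 x hx
      · have := hb x hxab
        simp only [hC, hxab, if_false]
        simp only [hx, if_true] at this ⊢
        omega
    · by_cases hxab : x = a ∨ x = b
      · simpa [hC, hxab] using h2 x hx
      · have := hb x hxab
        simp only [hC, hxab, if_false]
        simp only [hx, if_true] at this ⊢
        omega
    · have hya : x < a → ¬ a ≤ y := fun hxa hay => by
        have := h3 x a hxa.le (le_antisymm (hτ hxa.le) (hτxy ▸ hτ hay))
        have := h1 x hxa
        omega
      have hxb : b < y → ¬ x ≤ b := fun hby hxb => by
        have := h3 b y hby.le (le_antisymm (hτ hby.le) (hτxy ▸ hτ hxb))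
        have := h2 y hby
        omega
      by_cases hxa : x = a
      · simp [hC, hxa, ha]
      by_cases hyb : y = b
      · have : C h y = s := by simp [hC, hyb, hb']
        exact this ▸ C_le x
      have hxb' : x ≠ b := fun e => hxb (lt_of_le_of_ne (e ▸ hxy) (Ne.symm hyb)) e.le
      have hya' : y ≠ a := fun e => hya (lt_of_le_of_ne (e ▸ hxy) hxa) e.ge
      have hle : h (r y) ≤ h (r x) := h3 _ _
        (hrev x y hxy hτxy (fun ⟨p, q⟩ => hya (lt_of_le_of_ne p hxa) q)
          (fun ⟨p, q⟩ => hxb (lt_of_le_of_ne q (Ne.symm hyb)) p))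
        (by rw [(hrx y).1, (hrx x).1, hτxy])
      have e1 : x < a ↔ y < a := ⟨fun p => not_le.1 (hya p), fun p => hxy.trans_lt p⟩
      have e2 : b < x ↔ b < y := ⟨fun p => p.trans_le hxy, fun p => not_le.1 (hxb p)⟩
      simp only [hC, hxa, hxb', hya', hyb, or_self, if_false, e1, e2]
      omega
  have C_C {h} (hh : h ∈ labelings τ a b s) : C (C h) = h := by
    funext x
    by_cases hx : x = a ∨ x = b
    · simp [hC, hx]
    · obtain ⟨-, h1, h2, h3, h4⟩ := hrx x
      have hrx' : ¬(r x = a ∨ r x = b) := by rwa [h2, h4]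
      have := bounds hh (r x) hrx'
      simp only [hr x, h1, h3] at this
      simp only [hC, hx, hrx', if_false, hr x, h1, h3]
      omega
  have sum_C {h} (hh : h ∈ labelings τ a b s) :
      ∑ x, (C h x : ℤ) + ∑ x, (h x : ℤ) = n * s + a + b + 1 - n := by
    have hpt (x) : (C h x : ℤ) + h (r x) = s + (if x < a then 1 else 0) - (if b < x then 1 else 0) +
        (if x = a then (if b < a then 1 else 0) - (s : ℤ) else 0) +
        (if x = b then (s : ℤ) - (if b < a then 1 else 0) else 0) := by
      have hb := bounds hh x
      rw [mem_labelings] at hh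
      obtain ⟨-, ha, hb', -⟩ := hh
      obtain ⟨-, -, h2, -, h4⟩ := hrx x
      by_cases hxa : x = a
      · subst hxa
        simp [hC, h2.2 rfl, ha, hab]
      by_cases hxb : x = b
      · subst hxb
        simp [hC, h4.2 rfl, hb', hxa]
      have := hb (by tauto)
      simp only [hC, hxa, hxb, or_self, if_false]
      split_ifs at this ⊢ <;> omega
    have hs := sum_congr (rfl : (univ : Finset (Fin n)) = univ) fun x _ => hpt x
    simp only [sum_add_distrib, sum_sub_distrib, sum_ite_eq', mem_univ, if_true] at hs
    have e0 : ∑ x, (h (r x) : ℤ) = ∑ x, (h x : ℤ) :=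
      Equiv.sum_comp hr.toPerm fun x => (h x : ℤ)
    have e1 : (∑ x : Fin n, if x < a then (1 : ℤ) else 0) = a := by
      rw [sum_boole, filter_gt_eq_Iio, Fin.card_Iio]
    have e2 : (∑ x : Fin n, if b < x then (1 : ℤ) else 0) = n - 1 - b := by
      rw [sum_boole, filter_lt_eq_Ioi, Fin.card_Ioi]
      have := b.2
      omega
    rw [e0, e1, e2] at hs
    simp only [sum_const, card_univ, Fintype.card_fin, nsmul_eq_mul] at hs
    linarith
  refine sum_bij' (fun h _ => C h) (fun h _ => C h) (fun _ => C_mem) (fun _ => C_mem)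
    (fun _ => C_C) (fun _ => C_C) fun h hh => ?_
  rw [← sum_C hh]
  ring_nf

/-- Weakly increasing sequences from `0` to `K`. -/
def chains (m K : ℕ) : Finset (Fin (m + 1) → ℕ) :=
  (Fintype.piFinset fun _ => range (K + 1)).filter fun k =>
    k 0 = 0 ∧ k (Fin.last m) = K ∧ ∀ i j, i ≤ j → k i ≤ k j

lemma mem_chains {m K : ℕ} {k : Fin (m + 1) → ℕ} :
    k ∈ chains m K ↔ k 0 = 0 ∧ k (Fin.last m) = K ∧ Monotone k := by
  simp only [chains, mem_filter, Fintype.mem_piFinset, mem_range, Nat.lt_succ_iff,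
    and_iff_right_iff_imp, Monotone]
  exact fun h i => h.2.1 ▸ h.2.2 i _ (Fin.le_last i)

lemma sum_chains_reflect (m K : ℕ) (f : ℤ → ℤ) :
    ∑ k ∈ chains m K, f (∑ i, (k i : ℤ)) =
      ∑ k ∈ chains m K, f ((m + 1) * K - ∑ i, (k i : ℤ)) := by
  have le {k} (hk : k ∈ chains m K) (i) : k i ≤ K := by
    rw [mem_chains] at hk
    exact hk.2.1 ▸ hk.2.2 (Fin.le_last i)
  have mem {k} (hk : k ∈ chains m K) : (fun i => K - k i.rev) ∈ chains m K := by
    rw [mem_chains] at hk ⊢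
    refine ⟨by simp [hk.2.1], by simp [hk.1], fun i j hij => ?_⟩
    have := hk.2.2 (Fin.rev_le_rev.2 hij)
    dsimp only
    omega
  have inv {k} (hk : k ∈ chains m K) : (fun i : Fin (m + 1) => K - (K - k i.rev.rev)) = k := by
    funext i
    have := le hk i
    rw [Fin.rev_rev]
    omega
  refine sum_bij' (fun k _ i => K - k i.rev) (fun k _ i => K - k i.rev) (fun _ => mem)
    (fun _ => mem) (fun _ => inv) (fun _ => inv) fun k hk => ?_
  congr 1
  have h1 : ∑ i : Fin (m + 1), ((K - k i.rev : ℕ) : ℤ) = ∑ i : Fin (m + 1), ((K : ℤ) - k i.rev) :=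
    sum_congr rfl fun i _ => Nat.cast_sub (le hk _)
  have h2 : ∑ i : Fin (m + 1), (k i.rev : ℤ) = ∑ i, (k i : ℤ) :=
    Equiv.sum_comp Fin.revPerm fun i => (k i : ℤ)
  rw [h1, sum_sub_distrib, h2]
  simp

lemma desBelow_mono (π : Equiv.Perm (Fin n)) : Monotone (desBelow π) :=
  monotone_nat_of_le_succ fun i => by rw [desBelow_succ]; omega

/-- A permutation without descents between two positions increases between them. -/
lemma extWord_lt_of_desBelow_eq (π : Equiv.Perm (Fin n)) {i j : ℕ} (hij : i < j) (hj : j < n)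
    (h : desBelow π i = desBelow π j) : extWord π i < extWord π j := by
  induction j, hij using Nat.le_induction with
  | base =>
    have := extWord_ne π (show i < n by omega) hj (by omega)
    rw [Nat.succ_eq_add_one] at *
    rw [desBelow_succ] at h
    split_ifs at h <;> omega
  | succ j hij ih =>
    have h1 := desBelow_mono π (show i ≤ j by omega)
    have h2 := extWord_ne π (show j < n by omega) hj (by omega)
    rw [desBelow_succ] at h
    have h3 := ih (by omega) (by omega)
    split_ifs at h <;> omega

/-- The permutations from `a` to `b` in which every class of `τ` appears in increasing order. -/
def sortClass {m : ℕ} (τ : Fin (m + 1) → ℕ) (a b : Fin (m + 1)) :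
    Finset (Equiv.Perm (Fin (m + 1))) :=
  univ.filter fun π => π 0 = a ∧ π (Fin.last m) = b ∧
    ∀ x y, x ≤ y → τ x = τ y → π.symm x ≤ π.symm y

section Decomposition

variable {m : ℕ} {τ : Fin (m + 1) → ℕ} {a b : Fin (m + 1)} {s : ℕ} {h : Fin (m + 1) → ℕ}
  {π : Equiv.Perm (Fin (m + 1))}

lemma sort_le_sort_of_le (hπ : π = Tuple.sort h) {x y : Fin (m + 1)} (hxy : x ≤ y)
    (hh : h x ≤ h y) : π.symm x ≤ π.symm y := by
  obtain ⟨hmono, hst⟩ := Tuple.eq_sort_iff.1 hπ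
  by_contra! hlt
  have h1 := hmono hlt.le
  simp only [Function.comp_apply, Equiv.apply_symm_apply] at h1
  have h2 := hst _ _ hlt (by simpa using le_antisymm h1 hh)
  simp only [Equiv.apply_symm_apply] at h2
  exact absurd hxy (not_le.2 h2)

lemma mem_labelings_iff_of_sort (hπ : π = Tuple.sort h) :
    h ∈ labelings τ a b s ↔
      π ∈ sortClass τ a b ∧ h (π 0) = 0 ∧ h (π (Fin.last m)) = s := by
  obtain ⟨hmono, hst⟩ := Tuple.eq_sort_iff.1 hπ
  have hmono' (i j) (hij : i ≤ j) : h (π i) ≤ h (π j) := hmono hij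
  rw [mem_labelings, sortClass, mem_filter]
  constructor
  · rintro ⟨hle, ha, hb, hpos, hlt, hτ⟩
    have h0 : π 0 = a := by
      by_contra hne
      have h1 := hmono' 0 (π.symm a) (Fin.zero_le _)
      rw [Equiv.apply_symm_apply, ha] at h1
      have h2 : 0 < π.symm a := Fin.pos_of_ne_zero fun e => hne (by rw [← e]; simp)
      have h3 := hst _ _ h2 (by rw [Equiv.apply_symm_apply]; omega)
      rw [Equiv.apply_symm_apply] at h3
      have := hpos _ h3
      omega
    have h1 : π (Fin.last m) = b := by
      by_contra hne
      have h1 := hmono' (π.symm b) (Fin.last m) (Fin.le_last _)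
      rw [Equiv.apply_symm_apply, hb] at h1
      have h2 : π.symm b < Fin.last m :=
        Fin.lt_last_iff_ne_last.2 fun e => hne (by rw [← e]; simp)
      have h4 := hle (π (Fin.last m))
      have h3 := hst _ _ h2 (by rw [Equiv.apply_symm_apply]; omega)
      rw [Equiv.apply_symm_apply] at h3
      have := hlt _ h3
      omega
    exact ⟨⟨mem_univ _, h0, h1, fun x y hxy hτxy => sort_le_sort_of_le hπ hxy (hτ x y hxy hτxy)⟩,
      h0 ▸ ha, h1 ▸ hb⟩
  · rintro ⟨⟨-, rfl, rfl, hτ⟩, h0, h1⟩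
    have key (x) : h x = h (π (π.symm x)) := by simp
    refine ⟨fun x => ?_, h0, h1, fun x hx => ?_, fun x hx => ?_, fun x y hxy hτxy => ?_⟩
    · rw [key, ← h1]
      exact hmono' _ _ (Fin.le_last _)
    · by_contra hx0
      have h2 : 0 < π.symm x := Fin.pos_of_ne_zero fun e => by
        rw [Equiv.symm_apply_eq] at e
        exact hx.ne e
      have h3 := hst _ _ h2 (by rw [← key]; omega)
      rw [Equiv.apply_symm_apply] at h3
      exact lt_asymm hx h3
    · by_contra hx0
      have h2 : π.symm x < Fin.last m := Fin.lt_last_iff_ne_last.2 fun e => by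
        rw [Equiv.symm_apply_eq] at e
        exact hx.ne' e
      have h4 := hmono' _ _ h2.le
      rw [← key] at h4
      have h3 := hst _ _ h2 (by rw [← key]; omega)
      rw [Equiv.apply_symm_apply] at h3
      exact lt_asymm hx h3
    · rw [key x, key y]
      exact hmono' _ _ (hτ x y hxy hτxy)

lemma desBelow_add_le_of_sort (hπ : π = Tuple.sort h) {i j : Fin (m + 1)} (hij : i ≤ j) :
    desBelow π j + h (π i) ≤ desBelow π i + h (π j) := by
  obtain ⟨hmono, hst⟩ := Tuple.eq_sort_iff.1 hπ
  have hm : Monotone fun i : Fin (m + 1) => (h (π i) : ℤ) - desBelow π i := by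
    rw [Fin.monotone_iff_le_succ]
    intro i
    have h1 : h (π i.castSucc) ≤ h (π i.succ) := hmono i.castSucc_lt_succ.le
    have h2 := hst _ _ (i.castSucc_lt_succ)
    have h3 := extWord_val π i.castSucc
    have h4 := extWord_val π i.succ
    rw [Fin.lt_def] at h2
    simp only [Fin.val_castSucc, Fin.val_succ, desBelow_succ] at h3 h4 ⊢
    push_cast
    split_ifs <;> omega
  have := hm hij
  dsimp only at this
  omega

lemma eq_sort_of_monotone {k : Fin (m + 1) → ℕ} (hk : Monotone k) :
    π = Tuple.sort fun x => desBelow π (π.symm x) + k (π.symm x) := by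
  rw [Tuple.eq_sort_iff]
  constructor
  · intro i j hij
    have h1 := desBelow_mono π (show (i : ℕ) ≤ j from hij)
    have h2 := hk hij
    simp only [Function.comp_apply, Equiv.symm_apply_apply]
    omega
  · intro i j hij h
    have h1 := desBelow_mono π (show (i : ℕ) ≤ j from hij.le)
    have h2 := hk hij.le
    simp only [Equiv.symm_apply_apply] at h
    have := extWord_lt_of_desBelow_eq π hij j.2 (by omega)
    rw [Fin.lt_def]
    simpa using this

/-- Sorting a labeling, and subtracting the number of preceding descents from the sorted labels,
encodes labelings by a permutation and a weakly increasing sequence. -/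
lemma sum_labelings (τ : Fin (m + 1) → ℕ) (a b : Fin (m + 1)) (s : ℕ) (f : ℤ → ℤ) :
    ∑ h ∈ labelings τ a b s, f (∑ x, (h x : ℤ)) =
      ∑ π ∈ (sortClass τ a b).filter (fun π => desBelow π m ≤ s),
        ∑ k ∈ chains m (s - desBelow π m), f (comaj π + ∑ i, (k i : ℤ)) := by
  rw [sum_sigma']
  symm
  refine sum_bij' (fun p _ x => desBelow p.1 (p.1.symm x) + p.2 (p.1.symm x))
    (fun h _ => ⟨Tuple.sort h, fun i => h (Tuple.sort h i) - desBelow (Tuple.sort h) i⟩)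
    ?_ ?_ ?_ ?_ ?_
  · rintro ⟨π, k⟩ hp
    simp only [mem_sigma, mem_filter, mem_chains] at hp
    obtain ⟨⟨hπ, hs⟩, h0, h1, hk⟩ := hp
    refine (mem_labelings_iff_of_sort (eq_sort_of_monotone hk)).2 ⟨hπ, ?_, ?_⟩
    · simp [h0]
    · simp only [Equiv.symm_apply_apply, Fin.val_last, h1]
      omega
  · intro h hh
    obtain ⟨hπ, h0, h1⟩ := (mem_labelings_iff_of_sort rfl).1 hh
    have hle := fun i => desBelow_add_le_of_sort (rfl : _ = Tuple.sort h) (Fin.zero_le i)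
    have h2 := hle (Fin.last m)
    simp only [mem_sigma, mem_filter, mem_chains]
    simp only [h0, h1, Fin.val_zero, Fin.val_last, desBelow_zero] at h2 ⊢
    refine ⟨⟨hπ, by omega⟩, trivial, trivial, fun i j hij => ?_⟩
    have h3 := desBelow_add_le_of_sort (rfl : _ = Tuple.sort h) hij
    dsimp only
    omega
  · rintro ⟨π, k⟩ hp
    simp only [mem_sigma, mem_filter, mem_chains] at hp
    have hs := eq_sort_of_monotone (π := π) hp.2.2.2
    simp [← hs]
  · intro h hh
    obtain ⟨hπ, h0, h1⟩ := (mem_labelings_iff_of_sort rfl).1 hh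
    funext x
    have hle := desBelow_add_le_of_sort (rfl : _ = Tuple.sort h)
      (Fin.zero_le ((Tuple.sort h).symm x))
    simp only [h0, Equiv.apply_symm_apply] at hle ⊢
    simp only [Fin.val_zero, desBelow_zero] at hle
    omega
  · rintro ⟨π, k⟩ -
    congr 1
    rw [← Equiv.sum_comp π fun x => ((desBelow π (π.symm x) + k (π.symm x) : ℕ) : ℤ)]
    simp [comaj, sum_add_distrib]

/-- Among the permutations of a `sortClass` with `s` descents, `comaj` is symmetrically
distributed. -/
lemma sum_sortClass_reflect (hτ : Monotone τ) (hab : a ≠ b) (s : ℕ) (f : ℤ → ℤ) :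
    ∑ π ∈ (sortClass τ a b).filter (fun π => desBelow π m = s), f (comaj π) =
      ∑ π ∈ (sortClass τ a b).filter (fun π => desBelow π m = s),
        f ((m + 1) * s + a + b - m - comaj π) := by
  induction s using Nat.strong_induction_on generalizing f with
  | _ s ih =>
    have split (F : Equiv.Perm (Fin (m + 1)) → ℤ) :
        ∑ π ∈ (sortClass τ a b).filter (fun π => desBelow π m ≤ s), F π =
          ∑ π ∈ (sortClass τ a b).filter (fun π => desBelow π m = s), F π +
          ∑ d ∈ range s, ∑ π ∈ (sortClass τ a b).filter (fun π => desBelow π m = d), F π := by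
      have : ∑ π ∈ (sortClass τ a b).filter (fun π => desBelow π m ≤ s), F π =
          ∑ d ∈ range (s + 1), ∑ π ∈ (sortClass τ a b).filter (fun π => desBelow π m = d), F π := by
        rw [← sum_fiberwise_of_maps_to (t := range (s + 1)) (g := fun π => desBelow π m)]
        · refine sum_congr rfl fun d hd => sum_congr ?_ fun _ _ => rfl
          ext π
          simp only [mem_filter, mem_range] at *
          exact ⟨fun h => ⟨h.1.1, h.2⟩, fun h => ⟨⟨h.1, by omega⟩, h.2⟩⟩
        · intro π hπ
          simp only [mem_filter, mem_range] at *
          omega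
      rw [this, sum_range_succ, add_comm]
    have top (F : Equiv.Perm (Fin (m + 1)) → ℤ → ℤ) :
        ∑ π ∈ (sortClass τ a b).filter (fun π => desBelow π m = s),
          ∑ k ∈ chains m (s - desBelow π m), F π (∑ i, (k i : ℤ)) =
        ∑ π ∈ (sortClass τ a b).filter (fun π => desBelow π m = s), F π 0 := by
      refine sum_congr rfl fun π hπ => ?_
      have h0 : chains m 0 = {0} := by
        ext k
        rw [mem_chains, mem_singleton]
        constructor
        · rintro ⟨-, h1, h2⟩
          funext i
          exact Nat.le_zero.1 (h1 ▸ h2 (Fin.le_last i))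
        · rintro rfl
          exact ⟨rfl, rfl, fun _ _ _ => le_rfl⟩
      rw [(mem_filter.1 hπ).2, Nat.sub_self, h0, sum_singleton]
      simp
    have hrefl := sum_labelings_reflect hτ hab s f
    rw [sum_labelings τ a b s f, sum_labelings τ a b s fun z =>
      f (((m + 1 : ℕ) : ℤ) * s + a + b + 1 - ((m + 1 : ℕ) : ℤ) - z), split, split,
      top fun π z => f (comaj π + z), top fun π z =>
        f (((m + 1 : ℕ) : ℤ) * s + a + b + 1 - ((m + 1 : ℕ) : ℤ) - (comaj π + z))] at hrefl
    have hlow : ∑ d ∈ range s, ∑ π ∈ (sortClass τ a b).filter (fun π => desBelow π m = d),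
          ∑ k ∈ chains m (s - desBelow π m), f (comaj π + ∑ i, (k i : ℤ)) =
        ∑ d ∈ range s, ∑ π ∈ (sortClass τ a b).filter (fun π => desBelow π m = d),
          ∑ k ∈ chains m (s - desBelow π m),
            f (((m + 1 : ℕ) : ℤ) * s + a + b + 1 - ((m + 1 : ℕ) : ℤ) -
              (comaj π + ∑ i, (k i : ℤ))) := by
      refine sum_congr rfl fun d hd => ?_
      have hds : d < s := mem_range.1 hd
      have fix (F : Equiv.Perm (Fin (m + 1)) → (Fin (m + 1) → ℕ) → ℤ) :
          ∑ π ∈ (sortClass τ a b).filter (fun π => desBelow π m = d),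
            ∑ k ∈ chains m (s - desBelow π m), F π k =
          ∑ k ∈ chains m (s - d),
            ∑ π ∈ (sortClass τ a b).filter (fun π => desBelow π m = d), F π k := by
        rw [sum_comm]
        exact sum_congr rfl fun π hπ => by rw [(mem_filter.1 hπ).2]
      rw [fix fun π k => f (comaj π + ∑ i, (k i : ℤ)), fix fun π k =>
        f (((m + 1 : ℕ) : ℤ) * s + a + b + 1 - ((m + 1 : ℕ) : ℤ) - (comaj π + ∑ i, (k i : ℤ)))]
      have h1 := sum_chains_reflect m (s - d) fun z =>
        ∑ π ∈ (sortClass τ a b).filter (fun π => desBelow π m = d), f (comaj π + z)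
      rw [h1]
      refine sum_congr rfl fun k _ => ?_
      rw [ih d hds fun z => f (z + ((m + 1) * ((s - d : ℕ) : ℤ) - ∑ i, (k i : ℤ)))]
      refine sum_congr rfl fun π _ => ?_
      congr 1
      push_cast [Nat.cast_sub hds.le]
      ring
    rw [hlow] at hrefl
    have hfin := add_right_cancel hrefl
    simp only [add_zero] at hfin
    rw [hfin]
    refine sum_congr rfl fun π _ => ?_
    congr 1
    push_cast
    ring

end Decomposition

/-- The index of the block containing `x` when `Fin n` is cut after every element of `T`. -/
def blockIndex (T : Finset (Fin n)) (x : Fin n) : ℕ := #{y ∈ T | y < x}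

lemma blockIndex_mono (T : Finset (Fin n)) : Monotone (blockIndex T) := fun _ _ hxy =>
  card_le_card (monotone_filter_right T fun _ _ h => h.trans_le hxy)

lemma blockIndex_eq_succ_iff (T : Finset (Fin n)) {x y : Fin n} (hxy : (y : ℕ) = x + 1) :
    blockIndex T x = blockIndex T y ↔ x ∉ T := by
  have hlt : x < y := by rw [Fin.lt_def]; omega
  have hle (z : Fin n) (hz : z < y) : z = x ∨ z < x := by
    rw [Fin.lt_def] at hz ⊢; rw [Fin.ext_iff]; omega
  constructor
  · intro h hx
    refine h.not_lt (card_lt_card (ssubset_iff_of_subset ?_ |>.2 ⟨x, ?_, ?_⟩))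
    · exact monotone_filter_right T fun _ _ h => h.trans hlt
    · simp [hx, hlt]
    · simp
  · intro hx
    unfold blockIndex
    congr 1
    ext z
    simp only [mem_filter]
    constructor
    · exact fun ⟨h, h'⟩ => ⟨h, h'.trans hlt⟩
    · exact fun ⟨h, h'⟩ => ⟨h, (hle z h').resolve_left fun e => hx (e ▸ h)⟩

lemma IdSet_subset_iff (π : Equiv.Perm (Fin n)) (T : Finset (Fin n)) :
    IdSet π ⊆ T ↔ ∀ x y, x ≤ y → blockIndex T x = blockIndex T y → π.symm x ≤ π.symm y := by
  have mem_IdSet (i : Fin n) :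
      i ∈ IdSet π ↔ ∃ j : Fin n, (j : ℕ) = i + 1 ∧ π.symm j < π.symm i := by
    simp [IdSet, DesSet, pw, Equiv.Perm.inv_def]
  constructor
  · intro h x y hxy
    obtain ⟨y, hy⟩ := y
    rw [Fin.le_def] at hxy
    simp only at hxy
    induction y, hxy using Nat.le_induction with
    | base => exact fun _ => le_rfl
    | succ y hxy ih =>
      intro hb
      have hy' : y < n := by omega
      have h1 := blockIndex_mono T (show x ≤ ⟨y, hy'⟩ from hxy)
      have h2 := blockIndex_mono T (show (⟨y, hy'⟩ : Fin n) ≤ ⟨y + 1, hy⟩ from Nat.le_succ y)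
      have h3 := (blockIndex_eq_succ_iff T (x := ⟨y, hy'⟩) (y := ⟨y + 1, hy⟩) rfl).1 (by omega)
      refine (ih hy' (by omega)).trans (not_lt.1 fun hlt => h3 (h ?_))
      exact (mem_IdSet _).2 ⟨_, rfl, hlt⟩
  · intro h i hi
    obtain ⟨j, hj, hlt⟩ := (mem_IdSet i).1 hi
    by_contra hiT
    have hij : i ≤ j := by rw [Fin.le_def]; omega
    exact absurd (h i j hij ((blockIndex_eq_succ_iff T hj).2 hiT)) (not_le.2 hlt)

lemma sum_IdSet_reflect {m : ℕ} {a b : Fin (m + 1)} (hab : a ≠ b) (s : ℕ) (f : ℤ → ℤ)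
    (S : Finset (Fin (m + 1))) :
    ∑ π : Equiv.Perm (Fin (m + 1)) with
        (π 0 = a ∧ π (Fin.last m) = b ∧ desBelow π m = s) ∧ IdSet π = S, f (comaj π) =
      ∑ π : Equiv.Perm (Fin (m + 1)) with
        (π 0 = a ∧ π (Fin.last m) = b ∧ desBelow π m = s) ∧ IdSet π = S,
        f ((m + 1) * s + a + b - m - comaj π) := by
  induction S using Finset.strongInduction with
  | H T ih =>
    have fib (F : Equiv.Perm (Fin (m + 1)) → ℤ) :
        ∑ π ∈ (sortClass (blockIndex T) a b).filter (fun π => desBelow π m = s), F π =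
          (∑ S ∈ T.ssubsets, ∑ π : Equiv.Perm (Fin (m + 1)) with
            (π 0 = a ∧ π (Fin.last m) = b ∧ desBelow π m = s) ∧ IdSet π = S, F π) +
          ∑ π : Equiv.Perm (Fin (m + 1)) with
            (π 0 = a ∧ π (Fin.last m) = b ∧ desBelow π m = s) ∧ IdSet π = T, F π := by
      rw [ssubsets, sum_erase_add _ _ (mem_powerset_self T),
        ← sum_fiberwise_of_maps_to (t := T.powerset) (g := IdSet)]
      · refine sum_congr rfl fun S hS => sum_congr ?_ fun _ _ => rfl
        rw [mem_powerset] at hS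
        ext π
        simp only [sortClass, mem_filter, mem_univ, true_and, ← IdSet_subset_iff]
        constructor
        · tauto
        · rintro ⟨h, rfl⟩
          tauto
      · intro π hπ
        simp only [sortClass, mem_filter, mem_univ, true_and, ← IdSet_subset_iff] at hπ
        exact mem_powerset.2 hπ.1.2.2
    have h := sum_sortClass_reflect (blockIndex_mono T) hab s f
    rw [fib, fib, sum_congr rfl fun S hS => ih S (mem_ssubsets.1 hS)] at h
    exact add_left_cancel h

/-- If an involution of the keys preserves the sizes of the fibers of `K`, then it lifts to an
involution. -/
lemma exists_involutive_lift {α ι : Type*} [Fintype α] [DecidableEq ι] (K : α → ι) {R : ι → ι}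
    (hR : Function.Involutive R) (hcard : ∀ i, #{x | K x = i} = #{x | K x = R i}) :
    ∃ ψ : α → α, Function.Involutive ψ ∧ ∀ x, K (ψ x) = R (K x) := by
  have hrank : ∃ φ : α → ℕ, (∀ x y, K x = K y → φ x = φ y → x = y) ∧
      (∀ x, φ x < #{y | K y = K x}) ∧ ∀ i t, t < #{y | K y = i} → ∃ x, K x = i ∧ φ x = t := by
    have e (i : ι) : {x // K x = i} ≃ Fin #{x | K x = i} :=
      Fintype.equivFinOfCardEq (Fintype.card_subtype _)
    have he {x i} (h : K x = i) : (e (K x) ⟨x, rfl⟩ : ℕ) = e i ⟨x, h⟩ := by subst h; rfl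
    refine ⟨fun x => e (K x) ⟨x, rfl⟩, fun x y hxy h => ?_, fun x => Fin.is_lt _,
      fun i t ht => ?_⟩
    · dsimp only at h
      rw [he hxy] at h
      simpa using (e (K y)).injective (Fin.ext h)
    · have hx := ((e i).symm ⟨t, ht⟩).2
      refine ⟨(e i).symm ⟨t, ht⟩, hx, ?_⟩
      dsimp only
      rw [he hx]
      simp
  obtain ⟨φ, hinj, hlt, hsurj⟩ := hrank
  choose ψ hK hφ using fun x => hsurj (R (K x)) (φ x) (hcard (K x) ▸ hlt x)
  refine ⟨ψ, fun x => hinj _ _ ?_ ?_, hK⟩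
  · rw [hK, hK, hR]
  · rw [hφ, hφ]

lemma exists_involutive_comaj_reflect (m : ℕ) :
    ∃ ψ : Equiv.Perm (Fin (m + 2)) → Equiv.Perm (Fin (m + 2)), Function.Involutive ψ ∧
      ∀ π, ψ π 0 = π 0 ∧ ψ π (Fin.last (m + 1)) = π (Fin.last (m + 1)) ∧
        desBelow (ψ π) (m + 1) = desBelow π (m + 1) ∧ IdSet (ψ π) = IdSet π ∧
        (comaj (ψ π) : ℤ) = (m + 2) * desBelow π (m + 1) + π 0 + π (Fin.last (m + 1)) -
          (m + 1) - comaj π := by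
  let K (π : Equiv.Perm (Fin (m + 2))) :=
    ((π 0, π (Fin.last (m + 1)), desBelow π (m + 1), IdSet π), (comaj π : ℤ))
  let R (i : (Fin (m + 2) × Fin (m + 2) × ℕ × Finset (Fin (m + 2))) × ℤ) :=
    (i.1, (m + 2) * (i.1.2.2.1 : ℤ) + i.1.1 + i.1.2.1 - (m + 1) - i.2)
  have hR : Function.Involutive R := fun i => Prod.ext rfl (by simp only [R]; ring)
  have hcard (i) : #{π | K π = i} = #{π | K π = R i} := by
    obtain ⟨⟨a, b, s, S⟩, v⟩ := i
    by_cases hab : a = b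
    · subst hab
      have hne (π : Equiv.Perm (Fin (m + 2))) (h0 : π 0 = a) : π (Fin.last (m + 1)) ≠ a := by
        rw [← h0]
        exact π.injective.ne (Fin.last_pos).ne'
      rw [filter_false_of_mem, filter_false_of_mem] <;>
      · intro π _ h
        simp only [K, R, Prod.mk.injEq] at h
        exact hne π h.1.1 h.1.2.1
    · have h := sum_IdSet_reflect hab s (fun z => if z = v then 1 else 0) S
      rw [← sum_filter, ← sum_filter] at h
      simp only [filter_filter, sum_const, nsmul_eq_mul, mul_one, Nat.cast_inj] at h
      convert h using 2
      · ext π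
        simp [K, and_assoc]
      · ext π
        simp only [K, R, Prod.mk.injEq, and_assoc, mem_filter, mem_univ, true_and]
        push_cast
        constructor
        · rintro ⟨h0, h1, h2, h3, h4⟩
          exact ⟨h0, h1, h2, h3, by linarith⟩
        · rintro ⟨h0, h1, h2, h3, h4⟩
          exact ⟨h0, h1, h2, h3, by linarith⟩
  obtain ⟨ψ, hψ, h⟩ := exists_involutive_lift K hR hcard
  refine ⟨ψ, hψ, fun π => ?_⟩
  simpa [K, R, and_assoc] using h π

/-- There is an involution ψ on Sₙ preserving the first letter, last letter,
descent number and inverse descent set, and exchanging STAT and BAST. -/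
theorem stmt16 (n : ℕ) (hn : 0 < n) :
    ∃ ψ : Equiv.Perm (Fin n) → Equiv.Perm (Fin n), Function.Involutive ψ ∧
      ∀ π : Equiv.Perm (Fin n),
        pw (ψ π) ⟨0, hn⟩ = pw π ⟨0, hn⟩ ∧
        pw (ψ π) ⟨n - 1, Nat.sub_lt hn Nat.one_pos⟩ =
          pw π ⟨n - 1, Nat.sub_lt hn Nat.one_pos⟩ ∧
        desW (pw (ψ π)) = desW (pw π) ∧
        IdSet (ψ π) = IdSet π ∧
        STAT (pw (ψ π)) = BAST (pw π) ∧
        BAST (pw (ψ π)) = STAT (pw π) := by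
  obtain _ | _ | m := n
  · omega
  · refine ⟨id, fun _ => rfl, fun π => ⟨rfl, rfl, rfl, rfl, ?_⟩⟩
    have h1 := STAT_pw 0 π
    have h2 := BAST_pw 0 π
    have h3 : comaj π = 0 := by simp [comaj]
    simp [h3] at h1 h2
    simp [h1, h2]
  · obtain ⟨ψ, hψ, h⟩ := exists_involutive_comaj_reflect m
    refine ⟨ψ, hψ, fun π => ?_⟩
    obtain ⟨h0, h1, hd, hI, hc⟩ := h π
    have s1 := STAT_pw (m + 1) π
    have s2 := STAT_pw (m + 1) (ψ π)
    have b1 := BAST_pw (m + 1) π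
    have b2 := BAST_pw (m + 1) (ψ π)
    rw [h0, hd] at s2
    rw [h1, hd] at b2
    refine ⟨congrArg (fun x : Fin (m + 2) => (x : ℕ) + 1) h0,
      congrArg (fun x : Fin (m + 2) => (x : ℕ) + 1) h1, by rw [desW_pw, desW_pw, hd], hI, ?_, ?_⟩
    · zify at *
      linarith
    · zify at *
      linarith
end
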